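/- arXiv:1706.08134 — 5 statements merged into one kernel-verified Lean document; each statement's English description precedes it below -/
import Mathlib

section
/- Every simple graph F on 7 vertices with at most 12 edges satisfies F ↛ (P_3, C_7); that is, there exists a 2-coloring of the edges of F with no red copy of P_3 and no blue copy of C_7. -/
open SimpleGraph

/-- `F` contains a copy of `G` (an injective graph homomorphism from `G` to `F`). -/
def Contains {α β : Type*} (F : SimpleGraph α) (G : SimpleGraph β) : Prop :=
  ∃ f : G →g F, Function.Injective f

/-- `F → (G, H)`: for every red/blue coloring of the edges of `F` (given by the spanning
subgraph `R ≤ F` of red edges, the other edges of `F` being blue), there is a red copy of `G`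
or a blue copy of `H`. -/
def Arrows {α β γ : Type*} (F : SimpleGraph α) (G : SimpleGraph β) (H : SimpleGraph γ) : Prop :=
  ∀ R : SimpleGraph α, R ≤ F → Contains R G ∨ Contains (F \ R) H

namespace RamseyP3C7

/-- Edges of the complete graph on `Fin 7` except `36, 46, 56`, each with the bit mask of the
Hamiltonian cycles (numbered as in `cycs`) which avoid it. -/
def es : List ((Fin 7 × Fin 7) × ℕ) :=
  [((0, 6), 7422690037893887232910499708333283663151104),
   ((1, 6), 14878055160636683051155135421799242902351935),
   ((2, 6), 52857470083142515834940477376),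
   ((0, 5), 22283914392248899444901129471913947570372607),
   ((1, 5), 22234484285735444705387815309361626349084303),
   ((2, 5), 5444517870734780009362736761913392522234),
   ((3, 5), 20989701124650295079663447106157142499915873),
   ((4, 5), 1388691275086495414645400193750454706046228),
   ((0, 4), 20264490937449299208666932797001702530088959),
   ((1, 4), 18505899365654142481777509049031852485929843),
   ((2, 4), 22295302009887870429035477783336144104955117),
   ((3, 4), 4447852007514061890481834994824930690921098),
   ((0, 3), 12405641018960106343616113874303353912037375),
   ((1, 3), 6758297574840315418433761472128224539428348),
   ((2, 3), 22300743869627090692411997370531432875638551),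
   ((0, 2), 22300745198525568616937748729108389655736383),
   ((1, 2), 22300745198211175190278203328339731054591999),
   ((0, 1), 4525499209044731719110448509932768692535232)]

/-- Matchings, each with the bit mask of the Hamiltonian cycles which it does not meet. -/
def ms : List (List (Fin 7 × Fin 7) × ℕ) :=
  [([(1, 2), (3, 4), (5, 6)], 4447852007463355866472705638621025915695754),
   ([(1, 2), (3, 5), (4, 6)], 20989701124482965200433320230473320630581345),
   ([(1, 2), (3, 6), (4, 5)], 1388691274985083366627141481329550899217684),
   ([(1, 3), (2, 6), (4, 5)], 3327776102974812310705669376),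
   ([(1, 4), (2, 6), (3, 5)], 49749715527678370221442877504),
   ([(1, 5), (2, 6), (3, 4)], 12148892088231987884622464),
   ([(1, 6), (2, 3), (4, 5)], 936685701083109704999604726591898231308308),
   ([(1, 6), (2, 4), (3, 5)], 14003300019514980756924315132820628732973089),
   ([(1, 6), (2, 5), (3, 4)], 3419609117584837107779054114907307909130),
   ([(0, 3), (2, 6), (4, 5)], 3172996446321575875194127616),
   ([(0, 4), (2, 6), (3, 5)], 49674913233366343270154291264),
   ([(0, 5), (2, 6), (3, 4)], 10534620331936309444190716544),
   ([(0, 6), (2, 3), (4, 5)], 452005309196242557897785287357866610524160),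
   ([(0, 6), (2, 4), (3, 5)], 6985316455090704059759532002046596960223232),
   ([(0, 6), (2, 5), (3, 4)], 1705815876693939752287532712158751096832),
   ([(0, 1), (2, 4), (5, 6)], 4524394620580220972019366051931855916997824),
   ([(0, 1), (2, 5), (4, 6)], 1104858463933673495368473970358537708480),
   ([(0, 4), (1, 5), (2, 6)], 12904056304403735617506944),
   ([(0, 5), (1, 4), (2, 6)], 52844568536315882064210185024),
   ([(0, 1), (2, 3), (5, 6)], 4525498939369758411091563839296090291519232),
   ([(0, 3), (1, 5), (2, 6)], 10449024856177193678540416),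
   ([(0, 5), (1, 3), (2, 6)], 52857296928077322198924838336),
   ([(0, 3), (1, 4), (2, 6)], 42786305757997022816369642304),
   ([(0, 4), (1, 3), (2, 6)], 52161125660938643891269846464)]

/-- The (directed) Hamiltonian cycles in which both neighbours of `6` are among `0, 1, 2`. -/
def cycs : List (List (Fin 7)) :=
  [[6, 0, 1, 3, 4, 5, 2],
   [6, 0, 1, 3, 5, 4, 2],
   [6, 0, 1, 4, 3, 5, 2],
   [6, 0, 1, 4, 5, 3, 2],
   [6, 0, 1, 5, 3, 4, 2],
   [6, 0, 1, 5, 4, 3, 2],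
   [6, 0, 2, 3, 4, 5, 1],
   [6, 0, 2, 3, 5, 4, 1],
   [6, 0, 2, 4, 3, 5, 1],
   [6, 0, 2, 4, 5, 3, 1],
   [6, 0, 2, 5, 3, 4, 1],
   [6, 0, 2, 5, 4, 3, 1],
   [6, 0, 3, 1, 4, 5, 2],
   [6, 0, 3, 1, 5, 4, 2],
   [6, 0, 3, 2, 4, 5, 1],
   [6, 0, 3, 2, 5, 4, 1],
   [6, 0, 3, 4, 1, 5, 2],
   [6, 0, 3, 4, 2, 5, 1],
   [6, 0, 3, 4, 5, 1, 2],
   [6, 0, 3, 4, 5, 2, 1],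
   [6, 0, 3, 5, 1, 4, 2],
   [6, 0, 3, 5, 2, 4, 1],
   [6, 0, 3, 5, 4, 1, 2],
   [6, 0, 3, 5, 4, 2, 1],
   [6, 0, 4, 1, 3, 5, 2],
   [6, 0, 4, 1, 5, 3, 2],
   [6, 0, 4, 2, 3, 5, 1],
   [6, 0, 4, 2, 5, 3, 1],
   [6, 0, 4, 3, 1, 5, 2],
   [6, 0, 4, 3, 2, 5, 1],
   [6, 0, 4, 3, 5, 1, 2],
   [6, 0, 4, 3, 5, 2, 1],
   [6, 0, 4, 5, 1, 3, 2],
   [6, 0, 4, 5, 2, 3, 1],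
   [6, 0, 4, 5, 3, 1, 2],
   [6, 0, 4, 5, 3, 2, 1],
   [6, 0, 5, 1, 3, 4, 2],
   [6, 0, 5, 1, 4, 3, 2],
   [6, 0, 5, 2, 3, 4, 1],
   [6, 0, 5, 2, 4, 3, 1],
   [6, 0, 5, 3, 1, 4, 2],
   [6, 0, 5, 3, 2, 4, 1],
   [6, 0, 5, 3, 4, 1, 2],
   [6, 0, 5, 3, 4, 2, 1],
   [6, 0, 5, 4, 1, 3, 2],
   [6, 0, 5, 4, 2, 3, 1],
   [6, 0, 5, 4, 3, 1, 2],
   [6, 0, 5, 4, 3, 2, 1],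
   [6, 1, 0, 3, 4, 5, 2],
   [6, 1, 0, 3, 5, 4, 2],
   [6, 1, 0, 4, 3, 5, 2],
   [6, 1, 0, 4, 5, 3, 2],
   [6, 1, 0, 5, 3, 4, 2],
   [6, 1, 0, 5, 4, 3, 2],
   [6, 1, 2, 3, 4, 5, 0],
   [6, 1, 2, 3, 5, 4, 0],
   [6, 1, 2, 4, 3, 5, 0],
   [6, 1, 2, 4, 5, 3, 0],
   [6, 1, 2, 5, 3, 4, 0],
   [6, 1, 2, 5, 4, 3, 0],
   [6, 1, 3, 0, 4, 5, 2],
   [6, 1, 3, 0, 5, 4, 2],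
   [6, 1, 3, 2, 4, 5, 0],
   [6, 1, 3, 2, 5, 4, 0],
   [6, 1, 3, 4, 0, 5, 2],
   [6, 1, 3, 4, 2, 5, 0],
   [6, 1, 3, 4, 5, 0, 2],
   [6, 1, 3, 4, 5, 2, 0],
   [6, 1, 3, 5, 0, 4, 2],
   [6, 1, 3, 5, 2, 4, 0],
   [6, 1, 3, 5, 4, 0, 2],
   [6, 1, 3, 5, 4, 2, 0],
   [6, 1, 4, 0, 3, 5, 2],
   [6, 1, 4, 0, 5, 3, 2],
   [6, 1, 4, 2, 3, 5, 0],
   [6, 1, 4, 2, 5, 3, 0],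
   [6, 1, 4, 3, 0, 5, 2],
   [6, 1, 4, 3, 2, 5, 0],
   [6, 1, 4, 3, 5, 0, 2],
   [6, 1, 4, 3, 5, 2, 0],
   [6, 1, 4, 5, 0, 3, 2],
   [6, 1, 4, 5, 2, 3, 0],
   [6, 1, 4, 5, 3, 0, 2],
   [6, 1, 4, 5, 3, 2, 0],
   [6, 1, 5, 0, 3, 4, 2],
   [6, 1, 5, 0, 4, 3, 2],
   [6, 1, 5, 2, 3, 4, 0],
   [6, 1, 5, 2, 4, 3, 0],
   [6, 1, 5, 3, 0, 4, 2],
   [6, 1, 5, 3, 2, 4, 0],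
   [6, 1, 5, 3, 4, 0, 2],
   [6, 1, 5, 3, 4, 2, 0],
   [6, 1, 5, 4, 0, 3, 2],
   [6, 1, 5, 4, 2, 3, 0],
   [6, 1, 5, 4, 3, 0, 2],
   [6, 1, 5, 4, 3, 2, 0],
   [6, 2, 0, 3, 4, 5, 1],
   [6, 2, 0, 3, 5, 4, 1],
   [6, 2, 0, 4, 3, 5, 1],
   [6, 2, 0, 4, 5, 3, 1],
   [6, 2, 0, 5, 3, 4, 1],
   [6, 2, 0, 5, 4, 3, 1],
   [6, 2, 1, 3, 4, 5, 0],
   [6, 2, 1, 3, 5, 4, 0],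
   [6, 2, 1, 4, 3, 5, 0],
   [6, 2, 1, 4, 5, 3, 0],
   [6, 2, 1, 5, 3, 4, 0],
   [6, 2, 1, 5, 4, 3, 0],
   [6, 2, 3, 0, 4, 5, 1],
   [6, 2, 3, 0, 5, 4, 1],
   [6, 2, 3, 1, 4, 5, 0],
   [6, 2, 3, 1, 5, 4, 0],
   [6, 2, 3, 4, 0, 5, 1],
   [6, 2, 3, 4, 1, 5, 0],
   [6, 2, 3, 4, 5, 0, 1],
   [6, 2, 3, 4, 5, 1, 0],
   [6, 2, 3, 5, 0, 4, 1],
   [6, 2, 3, 5, 1, 4, 0],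
   [6, 2, 3, 5, 4, 0, 1],
   [6, 2, 3, 5, 4, 1, 0],
   [6, 2, 4, 0, 3, 5, 1],
   [6, 2, 4, 0, 5, 3, 1],
   [6, 2, 4, 1, 3, 5, 0],
   [6, 2, 4, 1, 5, 3, 0],
   [6, 2, 4, 3, 0, 5, 1],
   [6, 2, 4, 3, 1, 5, 0],
   [6, 2, 4, 3, 5, 0, 1],
   [6, 2, 4, 3, 5, 1, 0],
   [6, 2, 4, 5, 0, 3, 1],
   [6, 2, 4, 5, 1, 3, 0],
   [6, 2, 4, 5, 3, 0, 1],
   [6, 2, 4, 5, 3, 1, 0],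
   [6, 2, 5, 0, 3, 4, 1],
   [6, 2, 5, 0, 4, 3, 1],
   [6, 2, 5, 1, 3, 4, 0],
   [6, 2, 5, 1, 4, 3, 0],
   [6, 2, 5, 3, 0, 4, 1],
   [6, 2, 5, 3, 1, 4, 0],
   [6, 2, 5, 3, 4, 0, 1],
   [6, 2, 5, 3, 4, 1, 0],
   [6, 2, 5, 4, 0, 3, 1],
   [6, 2, 5, 4, 1, 3, 0],
   [6, 2, 5, 4, 3, 0, 1],
   [6, 2, 5, 4, 3, 1, 0]]

/-- Does some matching meet all cycles in `alive`? -/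
def hit (alive : ℕ) : Bool := ms.any fun M => Nat.beq (Nat.land alive M.2) 0

/-- Search over all graphs with at most `b` edges among the remaining ones. -/
def dfs : List ((Fin 7 × Fin 7) × ℕ) → ℕ → ℕ → Bool
  | [], alive, _ => hit alive
  | e :: es, alive, b =>
    (hit (Nat.land alive e.2) || dfs es (Nat.land alive e.2) b) &&
      (match b with
        | 0 => true
        | b + 1 => dfs es alive b)

theorem hit_sound {alive : ℕ} (h : hit alive = true) :
    ∃ M ∈ ms, ∀ i, alive.testBit i = true → M.2.testBit i = false := by
  obtain ⟨M, hM, h⟩ := List.any_eq_true.1 h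
  refine ⟨M, hM, fun i hi => ?_⟩
  have h0 : alive &&& M.2 = 0 := Nat.eq_of_beq_eq_true h
  have := congrArg (fun n => Nat.testBit n i) h0
  simpa [Nat.testBit_and, hi] using this

theorem dfs_sound (P : Fin 7 × Fin 7 → Bool) (l : List ((Fin 7 × Fin 7) × ℕ)) :
    ∀ (alive b : ℕ), dfs l alive b = true → l.countP (fun e => P e.1) ≤ b →
    ∃ M ∈ ms, ∀ i, alive.testBit i = true →
      (∀ e ∈ l, P e.1 = false → e.2.testBit i = true) → M.2.testBit i = false := by
  induction l with
  | nil =>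
    intro alive b h _
    obtain ⟨M, hM, h⟩ := hit_sound h
    exact ⟨M, hM, fun i hi _ => h i hi⟩
  | cons e l ih =>
    intro alive b h hc
    simp only [dfs] at h
    rw [Bool.and_eq_true, Bool.or_eq_true] at h
    cases hP : P e.1 with
    | false =>
      rw [List.countP_cons_of_neg (by simp [hP])] at hc
      have key : ∃ M ∈ ms, ∀ i, (alive &&& e.2).testBit i = true →
          (∀ e ∈ l, P e.1 = false → e.2.testBit i = true) → M.2.testBit i = false := by
        rcases h.1 with h | h
        · obtain ⟨M, hM, h⟩ := hit_sound h
          exact ⟨M, hM, fun i hi _ => h i hi⟩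
        · exact ih _ b h hc
      obtain ⟨M, hM, h⟩ := key
      refine ⟨M, hM, fun i hi hl => h i ?_ fun e' he' => hl e' (List.mem_cons_of_mem _ he')⟩
      rw [Nat.testBit_and, hi, hl e List.mem_cons_self hP]; rfl
    | true =>
      rw [List.countP_cons_of_pos (by simp [hP])] at hc
      cases b with
      | zero => omega
      | succ b =>
        obtain ⟨M, hM, h⟩ := ih alive b h.2 (by omega)
        exact ⟨M, hM, fun i hi hl => h i hi fun e' he' => hl e' (List.mem_cons_of_mem _ he')⟩

theorem dfs_eval : dfs es (2 ^ 144 - 1) 12 = true := by decide +kernel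

/-- Is `p` an edge of the cycle `c`? -/
def inCyc (c : List (Fin 7)) (p : Fin 7 × Fin 7) : Bool :=
  (c.zip (c.rotate 1)).any fun q => q == p || q == p.swap

theorem es_spec : ∀ i : Fin 144, ∀ e ∈ es,
    e.2.testBit i = true ∨ inCyc (cycs.getD i []) e.1 = true := by decide +kernel

theorem ms_spec : ∀ i : Fin 144, ∀ M ∈ ms,
    M.2.testBit i = true ∨ ∃ p ∈ M.1, inCyc (cycs.getD i []) p = true := by decide +kernel

theorem ms_matching : ∀ M ∈ ms, ∀ p ∈ M.1, ∀ q ∈ M.1, ∀ a b c : Fin 7,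
    (p = (a, b) ∨ p = (b, a)) → (q = (b, c) ∨ q = (c, b)) → a = c := by decide +kernel

set_option synthInstance.maxHeartbeats 400000 in
set_option synthInstance.maxSize 2000 in
set_option maxRecDepth 10000 in
theorem cycs_spec : ∀ a : Fin 7, a < 3 → ∀ f : Fin 7, f < 3 → f ≠ a →
    ∀ b : Fin 7, b ≠ 6 → b ≠ a → b ≠ f → ∀ c : Fin 7, c ≠ 6 → c ≠ a → c ≠ f → c ≠ b →
    ∀ d : Fin 7, d ≠ 6 → d ≠ a → d ≠ f → d ≠ b → d ≠ c →
    ∀ e : Fin 7, e ≠ 6 → e ≠ a → e ≠ f → e ≠ b → e ≠ c → e ≠ d →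
    ∃ i : Fin 144, cycs.getD i [] = [6, a, b, c, d, e, f] := by decide +kernel

theorem fin_aux : ∀ k j : Fin 7, k + 1 + j - (k + j) = 1 := by decide

theorem es_nodup : (es.map fun e => s(e.1.1, e.1.2)).Nodup := by decide +kernel

theorem exists_labelling {V : Type*} [Fintype V] (F : SimpleGraph V)
    (hV : Fintype.card V = 7) (hE : F.edgeSet.ncard ≤ 12) :
    ∃ g : Fin 7 ≃ V, ∀ i : Fin 7, F.Adj (g 6) (g i) → i < 3 := by
  classical
  have hE' : F.edgeFinset.card ≤ 12 := by
    rwa [← F.coe_edgeFinset, Set.ncard_coe_finset] at hE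
  have hex : ∃ v, F.degree v ≤ 3 := by
    by_contra! hcon
    have h1 := F.sum_degrees_eq_twice_card_edges
    have h2 : ∑ v : V, 4 ≤ ∑ v : V, F.degree v := Finset.sum_le_sum fun v _ => hcon v
    simp only [Finset.sum_const, Finset.card_univ, hV, smul_eq_mul] at h2
    omega
  obtain ⟨v, hv⟩ := hex
  have hc : 3 ≤ ((insert v (F.neighborFinset v))ᶜ).card := by
    rw [Finset.card_compl, hV]
    have := Finset.card_insert_le v (F.neighborFinset v)
    rw [F.card_neighborFinset_eq_degree] at this
    omega
  obtain ⟨T, hT, hT3⟩ := Finset.exists_subset_card_eq hc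
  obtain ⟨x, y, z, hxy, hxz, hyz, rfl⟩ := Finset.card_eq_three.1 hT3
  have hx := hT (show x ∈ _ by simp)
  have hy := hT (show y ∈ _ by simp)
  have hz := hT (show z ∈ _ by simp)
  simp only [Finset.mem_compl, Finset.mem_insert, mem_neighborFinset, not_or] at hx hy hz
  obtain ⟨g, hg⟩ := Finset.exists_equiv_extend_of_card_eq (α := Fin 7) (t := (Finset.univ : Finset V))
    (by simp [hV]) (s := {3, 4, 5, 6}) (f := ![v, v, v, x, y, z, v]) (by simp) (by
      intro i hi j hj hij
      fin_cases i <;> fin_cases j <;> simp_all [eq_comm])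
  let g' : Fin 7 ≃ V := g.trans (Equiv.subtypeUnivEquiv (by simp))
  have hg' : ∀ i : Fin 7, g' i = (g i : V) := fun _ => rfl
  refine ⟨g', fun i hi => ?_⟩
  have h3 := hg 3 (by simp)
  have h4 := hg 4 (by simp)
  have h5 := hg 5 (by simp)
  have h6 := hg 6 (by simp)
  rw [hg', hg'] at hi
  fin_cases i <;> simp_all

theorem count_le {V : Type*} [Fintype V] (F : SimpleGraph V) (g : Fin 7 ≃ V)
    (P : Fin 7 × Fin 7 → Bool) (hP : ∀ p, P p = true → F.Adj (g p.1) (g p.2)) :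
    es.countP (fun e => P e.1) ≤ F.edgeSet.ncard := by
  classical
  rw [List.countP_eq_length_filter]
  have hn : ((es.filter fun e => P e.1).map fun e => s(g e.1.1, g e.1.2)).Nodup := by
    have h1 := (es_nodup.sublist (List.filter_sublist (p := fun e => P e.1) (l := es)|>.map _)).map
      (Sym2.map.injective g.injective)
    simpa [List.map_map, Function.comp_def] using h1
  rw [← List.length_map (f := fun e : (Fin 7 × Fin 7) × ℕ => s(g e.1.1, g e.1.2)),
    ← List.toFinset_card_of_nodup hn, ← Set.ncard_coe_finset]
  refine Set.ncard_le_ncard ?_ (Set.toFinite _)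
  intro q hq
  simp only [List.coe_toFinset, List.mem_map, List.mem_filter, Set.mem_ofPred_eq] at hq
  obtain ⟨e, ⟨_, he⟩, rfl⟩ := hq
  exact hP _ he

/-- The red graph determined by a set of pairs. -/
def red {V : Type*} (F : SimpleGraph V) (g : Fin 7 ≃ V) (M : List (Fin 7 × Fin 7)) :
    SimpleGraph V where
  Adj x y := F.Adj x y ∧ ((g.symm x, g.symm y) ∈ M ∨ (g.symm y, g.symm x) ∈ M)
  symm := ⟨fun _ _ h => ⟨h.1.symm, h.2.symm⟩⟩
  loopless := ⟨fun _ h => F.irrefl h.1⟩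

end RamseyP3C7

open RamseyP3C7 in
theorem stmt_1 (V : Type*) [Fintype V] (F : SimpleGraph V)
    (hV : Fintype.card V = 7)
    (hE : F.edgeSet.ncard ≤ 12) :
    ¬ Arrows F (pathGraph 3) (cycleGraph 7) := by
  classical
  intro hA
  obtain ⟨g, hg⟩ := exists_labelling F hV hE
  obtain ⟨M, hM, hMc⟩ := dfs_sound (fun p => decide (F.Adj (g p.1) (g p.2))) es _ _ dfs_eval
    ((count_le F g _ (fun p hp => of_decide_eq_true hp)).trans hE)
  rcases hA (red F g M.1) (fun _ _ h => h.1) with ⟨f, hf⟩ | ⟨f, hf⟩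
  · have h01 : (red F g M.1).Adj (f 0) (f 1) := f.map_adj (by simp [pathGraph_adj])
    have h12 : (red F g M.1).Adj (f 1) (f 2) := f.map_adj (by simp [pathGraph_adj])
    have : g.symm (f 0) = g.symm (f 2) := by
      rcases h01.2 with h | h <;> rcases h12.2 with h' | h' <;>
      exact ms_matching M hM _ h _ h' _ (g.symm (f 1)) _ (by simp) (by simp)
    exact absurd (hf (g.symm.injective this)) (by decide)
  · have hb : Function.Bijective f :=
      (Fintype.bijective_iff_injective_and_card f).2 ⟨hf, by simp [hV]⟩
    obtain ⟨j, hj⟩ := hb.2 (g 6)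
    let h : Fin 7 → Fin 7 := fun k => g.symm (f (k + j))
    have hinj : Function.Injective h := fun a b hab =>
      add_right_cancel (hf (g.symm.injective hab))
    have h0 : h 0 = 6 := by simp [h, hj]
    have hadj : ∀ k, F.Adj (g (h k)) (g (h (k + 1))) ∧
        ¬ ((h k, h (k + 1)) ∈ M.1 ∨ (h (k + 1), h k) ∈ M.1) := by
      intro k
      have : (F \ red F g M.1).Adj (f (k + j)) (f (k + 1 + j)) :=
        f.map_adj (by rw [cycleGraph_adj]; right; exact fin_aux k j)
      rw [sdiff_adj] at this
      refine ⟨by simpa [h] using this.1, fun hm => this.2 ⟨this.1, hm⟩⟩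
    have hne : ∀ a b : Fin 7, a ≠ b → h a ≠ h b := fun a b hab => hinj.ne hab
    have h1 : h 1 < 3 := hg _ (by simpa [h0] using (hadj 0).1)
    have h6 : h 6 < 3 := hg _ (by
      have := (hadj 6).1
      rw [show (6 + 1 : Fin 7) = 0 from rfl, h0] at this
      exact this.symm)
    have hn6 : ∀ a : Fin 7, a ≠ 0 → h a ≠ 6 := fun a ha => h0 ▸ hne a 0 ha
    obtain ⟨i, hi⟩ := cycs_spec (h 1) h1 (h 6) h6 (hne _ _ (by decide))
      (h 2) (hn6 _ (by decide)) (hne _ _ (by decide)) (hne _ _ (by decide))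
      (h 3) (hn6 _ (by decide)) (hne _ _ (by decide)) (hne _ _ (by decide)) (hne _ _ (by decide))
      (h 4) (hn6 _ (by decide)) (hne _ _ (by decide)) (hne _ _ (by decide)) (hne _ _ (by decide))
      (hne _ _ (by decide))
      (h 5) (hn6 _ (by decide)) (hne _ _ (by decide)) (hne _ _ (by decide)) (hne _ _ (by decide))
      (hne _ _ (by decide)) (hne _ _ (by decide))
    replace hi : cycs.getD i [] = [h 0, h 1, h 2, h 3, h 4, h 5, h 6] := by rw [hi, h0]
    have hcyc : ∀ p, inCyc (cycs.getD i []) p = true →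
        ∃ k, (h k, h (k + 1)) = p ∨ (h k, h (k + 1)) = p.swap := by
      intro p hp
      rw [hi] at hp
      simp only [inCyc, List.any_eq_true, Bool.or_eq_true, beq_iff_eq] at hp
      obtain ⟨q, hq, hp⟩ := hp
      have : ∃ k, q = (h k, h (k + 1)) := by
        simp [List.rotate] at hq
        rcases hq with hq | hq | hq | hq | hq | hq | hq
        · exact ⟨0, hq⟩
        · exact ⟨1, hq⟩
        · exact ⟨2, hq⟩
        · exact ⟨3, hq⟩
        · exact ⟨4, hq⟩
        · exact ⟨5, hq⟩
        · exact ⟨6, hq⟩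
      obtain ⟨k, rfl⟩ := this
      exact ⟨k, hp⟩
    have hfalse : M.2.testBit i = false := by
      refine hMc i ?_ ?_
      · rw [Nat.testBit_two_pow_sub_one]; simp
      · intro e he hP
        rcases es_spec i e he with h' | h'
        · exact h'
        · exfalso
          obtain ⟨k, hk⟩ := hcyc _ h'
          have hP' : ¬ F.Adj (g e.1.1) (g e.1.2) := of_decide_eq_false hP
          rcases hk with hk | hk
          · rw [← hk] at hP'
            exact hP' (hadj k).1
          · have hk' : e.1 = (h (k + 1), h k) := by rw [← Prod.swap_swap e.1, ← hk]; rfl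
            rw [hk'] at hP'
            exact hP' (hadj k).1.symm
    rcases ms_spec i M hM with h' | ⟨p, hp, h'⟩
    · rw [hfalse] at h'; exact absurd h' (by decide)
    · obtain ⟨k, hk⟩ := hcyc _ h'
      apply (hadj k).2
      rcases hk with hk | hk
      · left; rw [hk]; exact hp
      · right
        have hk' : p = (h (k + 1), h k) := by rw [← Prod.swap_swap p, ← hk]; rfl
        rw [← hk']; exact hp
end

section
/- The restricted size Ramsey number r*(P_3, C_7) equals 13: there exists a simple graph F on 7 vertices with 13 edges such that F → (P_3, C_7), and every simple graph on 7 vertices with fewer than 13 edges fails to arrow (P_3, C_7). -/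
open SimpleGraph

/-- Bit test, written so that the kernel evaluates it quickly. -/
def tb (m n : Nat) : Bool := Nat.beq (Nat.land (Nat.shiftRight m n) 1) 1

theorem tb_eq (m n : Nat) : tb m n = m.testBit n := by
  have h1 : tb m n = Nat.beq ((m >>> n) &&& 1) 1 := rfl
  have h2 : m.testBit n = (1 &&& (m >>> n) != 0) := rfl
  rw [h1, h2, Nat.and_comm 1, Nat.and_one_is_mod]
  rcases Nat.mod_two_eq_zero_or_one (m >>> n) with h | h <;> rw [h] <;> rfl

/-- Evaluate the argument first. -/
def force (n : Nat) (f : Nat → Bool) : Bool :=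
  match n with
  | 0 => f 0
  | k + 1 => f (k + 1)

theorem force_eq (n : Nat) (f : Nat → Bool) : force n f = f n := by
  cases n <;> rfl

/-- Remove a number from a list. -/
def rm (v : Nat) : List Nat → List Nat
  | [] => []
  | x :: xs => bif Nat.beq x v then xs else x :: rm v xs

theorem mem_rm (v x : Nat) (hx : x ≠ v) (l : List Nat) (h : x ∈ l) : x ∈ rm v l := by
  induction l with
  | nil => exact h
  | cons y ys ih =>
    simp only [rm]
    cases hb : Nat.beq y v with
    | true =>
      have := Nat.eq_of_beq_eq_true hb
      rcases List.mem_cons.1 h with h | h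
      · exact absurd (h.trans this) hx
      · exact h
    | false =>
      rcases List.mem_cons.1 h with h | h
      · subst h; simp
      · exact List.mem_cons_of_mem _ (ih h)

/-- Adjacency in a graph on `{0,…,6}` coded by a bit mask (bit `7 i + j` for `i < j`). -/
def mAdj (m i j : Nat) : Bool :=
  bif Nat.ble j i then tb m (Nat.add (Nat.mul 7 j) i) else tb m (Nat.add (Nat.mul 7 i) j)

/-- Code of the set of elements of the list satisfying `T`, added to `acc`. -/
def enc (T : Nat → Bool) : List Nat → Nat → Nat
  | [], acc => acc
  | c :: cs, acc => enc T cs (bif T c then acc ||| 2 ^ c else acc)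

/-- Check `P` for all codes obtained by adding at most `k` bits from the list. -/
def enum (P : Nat → Bool) : List Nat → Nat → Nat → Bool
  | [], _, acc => P acc
  | c :: cs, k, acc =>
    enum P cs k acc && (match k with
      | 0 => true
      | k + 1 => force (Nat.lor acc (Nat.pow 2 c)) (enum P cs k))

theorem enum_sound (P : Nat → Bool) (T : Nat → Bool) (cs : List Nat) :
    ∀ (k acc : Nat), enum P cs k acc = true → cs.countP T ≤ k → P (enc T cs acc) = true := by
  induction cs with
  | nil => intro k acc h _; simpa [enum, enc] using h
  | cons c cs ih =>
    intro k acc h hk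
    simp only [enum, Bool.and_eq_true] at h
    cases hT : T c with
    | false =>
      simp only [enc, hT, cond_false]
      refine ih k acc h.1 ?_
      simpa [List.countP_cons, hT] using hk
    | true =>
      simp only [enc, hT, cond_true]
      have hk' : cs.countP T + 1 ≤ k := by simpa [List.countP_cons, hT] using hk
      cases k with
      | zero => omega
      | succ k =>
        have h2 := h.2
        simp only [force_eq] at h2
        exact ih k _ h2 (by omega)

theorem enc_testBit (T : Nat → Bool) (cs : List Nat) :
    ∀ (acc i : Nat), (enc T cs acc).testBit i = true ↔
      (acc.testBit i = true ∨ (i ∈ cs ∧ T i = true)) := by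
  induction cs with
  | nil => intro acc i; simp [enc]
  | cons c cs ih =>
    intro acc i
    simp only [enc]
    rw [ih]
    cases hT : T c with
    | false =>
      simp only [cond_false, List.mem_cons]
      constructor
      · tauto
      · rintro (h | ⟨rfl | h, h2⟩)
        · tauto
        · simp [hT] at h2
        · tauto
    | true =>
      simp only [cond_true, List.mem_cons, Nat.testBit_or, Bool.or_eq_true, Nat.testBit_two_pow,
        decide_eq_true_eq]
      constructor
      · rintro ((h | rfl) | h) <;> tauto
      · rintro (h | ⟨rfl | h, h2⟩) <;> tauto

theorem mAdj_le (m i j : Nat) (h : j ≤ i) : mAdj m i j = m.testBit (7 * j + i) := by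
  have h1 : Nat.ble j i = true := by rw [Nat.ble_eq]; exact h
  simp only [mAdj, h1, cond_true, tb_eq]
  rfl

theorem mAdj_lt (m i j : Nat) (h : i < j) : mAdj m i j = m.testBit (7 * i + j) := by
  have h1 : Nat.ble j i = false := by
    rw [Bool.eq_false_iff]; intro h'; rw [Nat.ble_eq] at h'; omega
  simp only [mAdj, h1, cond_false, tb_eq]
  rfl

theorem mAdj_symm (m i j : Nat) : mAdj m i j = mAdj m j i := by
  rcases Nat.lt_trichotomy i j with h | h | h
  · rw [mAdj_lt _ _ _ h, mAdj_le _ _ _ h.le]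
  · rw [h]
  · rw [mAdj_lt _ _ _ h, mAdj_le _ _ _ h.le]

theorem mAdj_bit (i j : Nat) : ∃ k, ∀ m, mAdj m i j = m.testBit k := by
  rcases Nat.lt_or_ge i j with h | h
  · exact ⟨_, fun m => mAdj_lt m i j h⟩
  · exact ⟨_, fun m => mAdj_le m i j h⟩

/-- No path through `k` vertices of `rem` leads from `cur` back to `0`. -/
def dfs (m : Nat) : Nat → Nat → List Nat → Bool
  | 0, cur, _ => !mAdj m cur 0
  | k + 1, cur, rem => rem.all fun v => bif mAdj m cur v then dfs m k v (rm v rem) else true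

theorem dfs_sound (m : Nat) : ∀ (l : List Nat) (cur : Nat) (rem : List Nat),
    dfs m l.length cur rem = true → l.Nodup → (∀ x ∈ l, x ∈ rem) →
    List.IsChain (fun a b => mAdj m a b = true) (cur :: (l ++ [0])) → False := by
  intro l
  induction l with
  | nil =>
    intro cur rem h _ _ hc
    simp [dfs] at h hc
    simp [h] at hc
  | cons v l ih =>
    intro cur rem h hn hs hc
    simp only [List.length_cons, dfs, List.all_eq_true] at h
    rw [List.cons_append, List.isChain_cons_cons] at hc
    have hv := h v (hs v (by simp))
    rw [List.nodup_cons] at hn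
    rw [hc.1, cond_true] at hv
    refine ih v _ hv hn.2 ?_ hc.2
    intro x hx
    refine mem_rm v x ?_ rem (hs x (by simp [hx]))
    rintro rfl
    exact hn.1 hx

def noHam (m : Nat) : Bool := dfs m 6 0 [1, 2, 3, 4, 5, 6]

theorem noHam_sound (m : Nat) (h : noHam m = true) (g : Fin 7 → Fin 7)
    (hg : Function.Injective g) (hadj : ∀ i, mAdj m (g i) (g (i + 1)) = true) : False := by
  obtain ⟨r, hr⟩ := (Finite.injective_iff_surjective.1 hg) 0
  have hinj : ∀ i j : Fin 7, i ≠ j → ((g (i + r) : Fin 7) : Nat) ≠ (g (j + r) : Fin 7) := by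
    intro i j hij he
    exact hij (add_right_cancel (hg (Fin.ext he)))
  have ha : ∀ i : Fin 7, mAdj m (g (i + r)) (g (i + 1 + r)) = true := by
    intro i
    have := hadj (i + r)
    rwa [add_right_comm] at this
  have h0 : ((g (0 + r) : Fin 7) : Nat) = 0 := by simp [hr]
  have hpos : ∀ i : Fin 7, i ≠ 0 → ((g (i + r) : Fin 7) : Nat) ∈ [1, 2, 3, 4, 5, 6] := by
    intro i hi
    have h1 := hinj i 0 hi
    rw [h0] at h1
    have h2 := (g (i + r)).isLt
    simp only [List.mem_cons, List.not_mem_nil, or_false]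
    omega
  have a0 := ha 0
  have a1 := ha 1
  have a2 := ha 2
  have a3 := ha 3
  have a4 := ha 4
  have a5 := ha 5
  have a6 := ha 6
  rw [h0] at a0
  have e6 : (6 + 1 + r : Fin 7) = 0 + r := by rw [show (6 + 1 : Fin 7) = 0 from rfl]
  rw [e6, h0] at a6
  refine dfs_sound m ([1, 2, 3, 4, 5, 6].map fun i : Fin 7 => ((g (i + r) : Fin 7) : Nat))
    0 [1, 2, 3, 4, 5, 6] h ?_ ?_ ?_
  · refine List.Nodup.map ?_ (by decide)
    intro i j hij
    by_contra hne
    exact hinj i j hne hij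
  · intro x hx
    obtain ⟨i, hi, rfl⟩ := List.mem_map.1 hx
    refine hpos i ?_
    rintro rfl
    revert hi
    decide
  · simp only [List.map_cons, List.map_nil, List.cons_append, List.nil_append,
      List.isChain_cons_cons, List.isChain_singleton, and_true]
    exact ⟨a0, a1, a2, a3, a4, a5, a6⟩

/-- Matchings that destroy all Hamiltonian cycles of the graphs considered. -/
def mList : List Nat :=
  [33555008,
   8590065666,
   2199023386626,
   8589935168,
   133184,
   8590983176,
   135184,
   34078722,
   8724152324,
   2199023256072,
   133152,
   2199023256580,
   263232,
   33562628,
   67109392]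

def chords : List Nat := [2, 3, 4, 5, 10, 11, 12, 13, 18, 19, 20, 26, 27, 34]
def cycEdges : List Nat := [1, 6, 9, 17, 25, 33, 41]

/-- The chords at each vertex. -/
def starList : List (Fin 7 × Nat) := [(0, 60), (1, 15360), (2, 1835012), (3, 201327624), (4, 17180133392), (5, 67637280), (6, 17315143680)]

def good (m : Nat) : Bool :=
  (starList.any fun s => Nat.beq (Nat.land m s.2) 0) || mList.any fun M => force (Nat.xor m (Nat.land m M)) noHam

set_option maxRecDepth 100000 in
theorem enum_good : enum good chords 5 2207646876226 = true := by decide +kernel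

theorem star_cover : ∀ s ∈ starList, ∀ w : Fin 7,
    w = s.1 + 1 ∨ w = s.1 - 1 ∨ w = s.1 ∨ mAdj s.2 s.1 w = true := by decide +kernel

theorem fin7_ne : ∀ i : Fin 7, i + 1 ≠ i - 1 := by decide

theorem land_zero {m n : Nat} (h : Nat.beq (Nat.land m n) 0 = true) (k : Nat)
    (ha : m.testBit k = true) (hb : n.testBit k = true) : False := by
  have hz : m &&& n = 0 := Nat.eq_of_beq_eq_true h
  have := congrArg (fun n => n.testBit k) hz
  simp [ha, hb] at this

theorem mList_matching : ∀ M ∈ mList, ∀ a b c : Fin 7,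
    mAdj M a b = true → mAdj M b c = true → a = c := by decide +kernel

theorem path_adj01 : (pathGraph 3).Adj 0 1 := by simp [pathGraph_adj]
theorem path_adj12 : (pathGraph 3).Adj 1 2 := by simp [pathGraph_adj]

theorem cyc_adj (i : Fin 7) : (cycleGraph 7).Adj i (i + 1) := by
  rw [cycleGraph_adj]; right; simp

theorem cover : ∀ i j : Fin 7, i < j →
    ((2207646876226 : Nat).testBit (7 * i + j) = true ∨ (7 * i.val + j.val) ∈ chords) := by
  decide +kernel

theorem idx_div (i j : Fin 7) : Fin.ofNat 7 ((7 * i.val + j.val) / 7) = i := by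
  apply Fin.ext; simp only [Fin.ofNat]; omega
theorem idx_mod (i j : Fin 7) : Fin.ofNat 7 ((7 * i.val + j.val) % 7) = j := by
  apply Fin.ext; simp only [Fin.ofNat]; omega

theorem list_inj : ∀ c ∈ cycEdges ++ chords, ∀ d ∈ cycEdges ++ chords,
    s(Fin.ofNat 7 (c / 7), Fin.ofNat 7 (c % 7)) = s(Fin.ofNat 7 (d / 7), Fin.ofNat 7 (d % 7)) →
    c = d := by decide +kernel

theorem cyc_consec : ∀ c ∈ cycEdges, Fin.ofNat 7 (c % 7) = Fin.ofNat 7 (c / 7) + 1 ∨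
    Fin.ofNat 7 (c / 7) = Fin.ofNat 7 (c % 7) + 1 := by decide +kernel

open Classical in
theorem lower (V : Type) [Fintype V] (F : SimpleGraph V) (hV : Fintype.card V = 7)
    (hF : F.edgeSet.ncard < 13) : ¬ Arrows F (pathGraph 3) (cycleGraph 7) := by
  intro h
  rcases h ⊥ bot_le with ⟨f, _⟩ | ⟨f, hf⟩
  · exact f.map_adj path_adj01
  have hbij : Function.Bijective f :=
    (Fintype.bijective_iff_injective_and_card f).2 ⟨hf, by simp [hV]⟩
  let e : Fin 7 ≃ V := Equiv.ofBijective f hbij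
  have he : ∀ i, e i = f i := fun i => rfl
  have hcyc : ∀ i : Fin 7, F.Adj (e i) (e (i + 1)) := fun i => by
    have := f.map_adj (cyc_adj i)
    exact this.1
  let T : Nat → Bool := fun c => decide (F.Adj (e (Fin.ofNat 7 (c / 7))) (e (Fin.ofNat 7 (c % 7))))
  have hTc : cycEdges.countP T = 7 := by
    have : cycEdges.countP T = cycEdges.length := by
      rw [List.countP_eq_length]
      intro c hc
      simp only [T, decide_eq_true_eq]
      rcases cyc_consec c hc with h1 | h1
      · rw [h1]; exact hcyc _
      · rw [h1]; exact (hcyc _).symm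
    rw [this]; rfl
  have hcount : (cycEdges ++ chords).countP T ≤ F.edgeSet.ncard := by
    let A : Finset Nat := ((cycEdges ++ chords).filter T).toFinset
    have hA : A.card = (cycEdges ++ chords).countP T := by
      rw [List.countP_eq_length_filter]
      exact List.toFinset_card_of_nodup (List.Nodup.filter _ (by decide +kernel))
    rw [← hA, ← Set.ncard_coe_finset]
    refine Set.ncard_le_ncard_of_injOn
      (fun c => s(e (Fin.ofNat 7 (c / 7)), e (Fin.ofNat 7 (c % 7)))) ?_ ?_ (Set.toFinite _)
    · intro c hc
      have hc' : c ∈ A := hc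
      simp only [A, List.mem_toFinset, List.mem_filter] at hc'
      simpa [T] using hc'.2
    · intro c hc d hd hcd
      have hc' : c ∈ A := hc
      have hd' : d ∈ A := hd
      simp only [A, List.mem_toFinset, List.mem_filter] at hc' hd'
      refine list_inj c hc'.1 d hd'.1 ?_
      have := congrArg (Sym2.map e.symm) hcd
      simpa only [Sym2.map_mk, Equiv.symm_apply_apply] using this
  rw [List.countP_append, hTc] at hcount
  have hgood := enum_sound good T chords 5 _ enum_good (by omega)
  set m := enc T chords 2207646876226 with hm
  have hmadj0 : ∀ i j : Fin 7, i < j → F.Adj (e i) (e j) → mAdj m i j = true := by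
    intro i j hij ha
    rw [mAdj_lt _ _ _ hij, hm, enc_testBit]
    rcases cover i j hij with h1 | h1
    · exact Or.inl h1
    · refine Or.inr ⟨h1, ?_⟩
      simp only [T, idx_div, idx_mod, decide_eq_true_eq]
      exact ha
  have hmadj : ∀ i j : Fin 7, F.Adj (e i) (e j) → mAdj m i j = true := by
    intro i j ha
    rcases lt_trichotomy i j with h1 | h1 | h1
    · exact hmadj0 i j h1 ha
    · exact absurd (congrArg e h1) ha.ne
    · rw [mAdj_symm]; exact hmadj0 j i h1 ha.symm
  rcases Bool.or_eq_true_iff.1 hgood with hst | hgood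
  · obtain ⟨⟨v, z⟩, hs, hz⟩ := List.any_eq_true.1 hst
    have hnb : ∀ w, F.Adj (e v) (e w) → w = v + 1 ∨ w = v - 1 := by
      intro w hw
      rcases star_cover _ hs w with h1 | h1 | h1 | h1
      · exact Or.inl h1
      · exact Or.inr h1
      · exact absurd (congrArg e h1).symm hw.ne
      · have h2 := hmadj v w hw
        obtain ⟨k, hk⟩ := mAdj_bit v w
        rw [hk] at h1 h2
        exact (land_zero hz k h2 h1).elim
    let R : SimpleGraph V :=
      { Adj := fun x y => F.Adj x y ∧ s(x, y) = s(e v, e (v + 1))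
        symm := ⟨fun x y hxy => ⟨hxy.1.symm, by rw [Sym2.eq_swap]; exact hxy.2⟩⟩
        loopless := ⟨fun x hx => hx.1.ne rfl⟩ }
    rcases h R (fun x y hxy => hxy.1) with ⟨p, hp⟩ | ⟨q, hq⟩
    · have h1 := (p.map_adj path_adj01).2
      have h2 := (p.map_adj path_adj12).2
      rw [← h2, Sym2.eq_swap] at h1
      have h4 := hp (Sym2.congr_right.1 h1)
      exact absurd h4 (by decide)
    · have hqb : Function.Bijective q :=
        (Fintype.bijective_iff_injective_and_card q).2 ⟨hq, by simp [hV]⟩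
      obtain ⟨i, hi⟩ := hqb.2 (e v)
      have key : ∀ j, (cycleGraph 7).Adj i j → q j = e (v - 1) := by
        intro j hj
        have h1 := q.map_adj hj
        rw [hi] at h1
        obtain ⟨w, hw⟩ := e.surjective (q j)
        rw [← hw] at h1 ⊢
        rcases hnb w h1.1 with h2 | h2
        · exact absurd ⟨h1.1, by rw [h2]⟩ h1.2
        · rw [h2]
      have k1 := key (i + 1) (cyc_adj i)
      have k2 := key (i - 1) (by simpa using (cyc_adj (i - 1)).symm)
      exact fin7_ne i (hq (k1.trans k2.symm))
  obtain ⟨M, hM, hno⟩ := List.any_eq_true.1 hgood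
  rw [force_eq] at hno
  replace hno : noHam (m ^^^ (m &&& M)) = true := hno
  let R : SimpleGraph V :=
    { Adj := fun x y => F.Adj x y ∧ mAdj M (e.symm x) (e.symm y) = true
      symm := ⟨fun x y hxy => ⟨hxy.1.symm, by rw [mAdj_symm]; exact hxy.2⟩⟩
      loopless := ⟨fun x hx => hx.1.ne rfl⟩ }
  rcases h R (fun x y hxy => hxy.1) with ⟨p, hp⟩ | ⟨q, hq⟩
  · have h1 := (p.map_adj path_adj01).2
    have h2 := (p.map_adj path_adj12).2
    have h3 := mList_matching M hM _ _ _ h1 h2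
    have h4 := hp (e.symm.injective h3)
    exact absurd h4 (by decide)
  · refine noHam_sound _ hno (fun i => e.symm (q i)) (e.symm.injective.comp hq) ?_
    intro i
    have h1 := q.map_adj (cyc_adj i)
    have h2 : F.Adj (q i) (q (i + 1)) := h1.1
    have h3 : ¬ mAdj M (e.symm (q i)) (e.symm (q (i + 1))) = true := fun h' => h1.2 ⟨h2, h'⟩
    have h4 := hmadj (e.symm (q i)) (e.symm (q (i + 1))) (by simpa using h2)
    obtain ⟨k, hk⟩ := mAdj_bit (e.symm (q i)) (e.symm (q (i + 1)))
    rw [hk] at h3 h4 ⊢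
    simp [h3, h4]

/-- The extremal graph with 13 edges. -/
def extG : SimpleGraph (Fin 7) where
  Adj i j := mAdj 2207781628494 i j = true
  symm := ⟨fun i j h => by rw [mAdj_symm]; exact h⟩
  loopless := ⟨by decide +kernel⟩

instance : DecidableRel extG.Adj := fun i j => inferInstanceAs (Decidable (mAdj 2207781628494 i j = true))

/-- Edges of `extG`, each with the mask of the other edges that share a vertex with it. -/
def extList : List (Nat × Nat) := [(1, 10828),
   (2, 655946),
   (3, 167903302),
   (6, 2199157481486),
   (9, 665606),
   (11, 8623497730),
   (13, 2199157475906),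
   (17, 168296972),
   (19, 2207613321732),
   (25, 8724285448),
   (27, 2199056949320),
   (33, 2199057336320),
   (41, 8724684864)]

def extEdges : List Nat := extList.map Prod.fst

/-- Check `P` for all codes of matchings. -/
def enumM (P : Nat → Bool) : List (Nat × Nat) → Nat → Bool
  | [], acc => P acc
  | c :: cs, acc =>
    enumM P cs acc && (bif Nat.beq (Nat.land acc c.2) 0 then
      force (Nat.lor acc (Nat.pow 2 c.1)) (enumM P cs) else true)

theorem enumM_sound (P : Nat → Bool) (T : Nat → Bool) (cs : List (Nat × Nat))
    (hno : ∀ c ∈ cs, T c.1 = true → ∀ d, T d = true → c.2.testBit d = true → False) :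
    ∀ acc : Nat, (∀ d, acc.testBit d = true → T d = true) → enumM P cs acc = true →
      P (enc T (cs.map Prod.fst) acc) = true := by
  induction cs with
  | nil => intro acc _ h; simpa [enumM, enc] using h
  | cons c cs ih =>
    intro acc hacc h
    have ih' := ih fun c' hc' => hno c' (List.mem_cons_of_mem _ hc')
    simp only [enumM, Bool.and_eq_true] at h
    cases hT : T c.1 with
    | false =>
      simp only [List.map_cons, enc, hT, cond_false]
      exact ih' acc hacc h.1
    | true =>
      simp only [List.map_cons, enc, hT, cond_true]
      have hz : Nat.beq (Nat.land acc c.2) 0 = true := by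
        have h0 : acc &&& c.2 = 0 := by
          apply Nat.eq_of_testBit_eq
          intro d
          rw [Nat.testBit_and, Nat.zero_testBit, Bool.eq_false_iff]
          intro hd
          rw [Bool.and_eq_true] at hd
          exact hno c (by simp) hT d (hacc d hd.1) hd.2
        have h1 : Nat.land acc c.2 = 0 := h0
        rw [h1]; rfl
      have h2 := h.2
      rw [hz, cond_true, force_eq] at h2
      refine ih' _ ?_ h2
      intro d hd
      have hd' : (acc ||| 2 ^ c.1).testBit d = true := hd
      rw [Nat.testBit_or, Bool.or_eq_true, Nat.testBit_two_pow, decide_eq_true_eq] at hd'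
      rcases hd' with hd' | hd'
      · exact hacc d hd'
      · rw [← hd']; exact hT

theorem extList_lt : ∀ c ∈ extList, c.2 < 2 ^ 49 := by decide +kernel

/-- Two edges (as codes) sharing exactly one vertex. -/
def Inc (c d : Nat) : Prop :=
  (Fin.ofNat 7 (c / 7) = Fin.ofNat 7 (d / 7) ∧ Fin.ofNat 7 (c % 7) ≠ Fin.ofNat 7 (d % 7)) ∨
  (Fin.ofNat 7 (c / 7) = Fin.ofNat 7 (d % 7) ∧ Fin.ofNat 7 (c % 7) ≠ Fin.ofNat 7 (d / 7)) ∨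
  (Fin.ofNat 7 (c % 7) = Fin.ofNat 7 (d / 7) ∧ Fin.ofNat 7 (c / 7) ≠ Fin.ofNat 7 (d % 7)) ∨
  (Fin.ofNat 7 (c % 7) = Fin.ofNat 7 (d % 7) ∧ Fin.ofNat 7 (c / 7) ≠ Fin.ofNat 7 (d / 7))

instance (c d : Nat) : Decidable (Inc c d) := by unfold Inc; infer_instance

theorem extList_inc : ∀ c ∈ extList, ∀ d < 49, tb c.2 d = true → Inc c.1 d := by
  decide +kernel

def hamList : List (Nat × (Fin 7 → Fin 7)) :=
  [(2207747540998, ![0, 1, 4, 5, 6, 3, 2]),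
   (8624022088, ![0, 3, 4, 5, 2, 1, 6]),
   (2199191554054, ![0, 1, 4, 3, 6, 5, 2]),
   (8724809794, ![0, 1, 4, 5, 2, 3, 6]),
   (2207646883846, ![0, 1, 6, 5, 4, 3, 2]),
   (2199057336904, ![0, 3, 4, 1, 2, 5, 6]),
   (2207613323848, ![0, 3, 2, 1, 4, 5, 6]),
   (8758239238, ![0, 1, 6, 3, 4, 5, 2]),
   (8590600264, ![0, 3, 2, 5, 4, 1, 6]),
   (2199057344524, ![0, 2, 5, 6, 1, 4, 3])]

def leaf (m : Nat) : Bool :=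
  hamList.any fun p => Nat.beq (Nat.land m p.1) 0

set_option maxRecDepth 100000 in
theorem enum_leaf : enumM leaf extList 0 = true := by decide +kernel

theorem hamList_ok : ∀ p ∈ hamList, Function.Injective p.2 ∧
    ∀ i, mAdj 2207781628494 (p.2 i) (p.2 (i + 1)) = true ∧ mAdj p.1 (p.2 i) (p.2 (i + 1)) = true := by
  decide +kernel

theorem ext_cover : ∀ i j : Fin 7, i < j → extG.Adj i j → (7 * i.val + j.val) ∈ extEdges := by
  decide +kernel

theorem ext_card : extG.edgeSet.ncard = 13 := by
  rw [Set.ncard_eq_toFinset_card']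
  decide +kernel

theorem contains_path {R : SimpleGraph (Fin 7)} {x y z : Fin 7} (r1 : R.Adj x y)
    (r2 : R.Adj y z) (r3 : x ≠ z) : Contains R (pathGraph 3) := by
  refine ⟨⟨![x, y, z], ?_⟩, ?_⟩
  · intro a b hab
    rw [pathGraph_adj] at hab
    fin_cases a <;> fin_cases b <;> simp at hab ⊢ <;>
      first | exact r1 | exact r2 | exact r1.symm | exact r2.symm
  · intro a b hab
    have n1 := r1.ne
    have n2 := r2.ne
    fin_cases a <;> fin_cases b <;> simp_all

open Classical in
theorem ext_arrows : Arrows extG (pathGraph 3) (cycleGraph 7) := by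
  intro R hR
  let T : Nat → Bool := fun c => decide (R.Adj (Fin.ofNat 7 (c / 7)) (Fin.ofNat 7 (c % 7)))
  by_cases hP : Contains R (pathGraph 3)
  · exact Or.inl hP
  have hleaf := enumM_sound leaf T extList (by
    intro c hc hTc d hTd hb
    have hd : d < 49 := by
      by_contra hd
      have h1 := Nat.testBit_lt_two_pow (lt_of_lt_of_le (extList_lt c hc)
        (Nat.pow_le_pow_right (by norm_num) (not_lt.1 hd)))
      rw [h1] at hb
      exact Bool.false_ne_true hb
    simp only [T, decide_eq_true_eq] at hTc hTd
    apply hP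
    rcases extList_inc c hc d hd (by rw [tb_eq]; exact hb) with h | h | h | h
    · rw [h.1] at hTc
      exact contains_path hTc.symm hTd h.2
    · rw [h.1] at hTc
      exact contains_path hTc.symm hTd.symm h.2
    · rw [h.1] at hTc
      exact contains_path hTc hTd h.2
    · rw [h.1] at hTc
      exact contains_path hTc hTd.symm h.2) 0 (by simp) enum_leaf
  replace hleaf : leaf (enc T extEdges 0) = true := hleaf
  set m := enc T extEdges 0 with hm
  have hm0 : ∀ i j : Fin 7, i < j → (mAdj m i j = true ↔ R.Adj i j) := by
    intro i j hij
    rw [mAdj_lt _ _ _ hij, hm, enc_testBit]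
    simp only [T, idx_div, idx_mod, decide_eq_true_eq, Nat.zero_testBit, Bool.false_eq_true,
      false_or]
    exact ⟨fun h => h.2, fun h => ⟨ext_cover i j hij (hR h), h⟩⟩
  have hm1 : ∀ i j : Fin 7, R.Adj i j → mAdj m i j = true := by
    intro i j hr
    rcases lt_trichotomy i j with h1 | h1 | h1
    · exact (hm0 i j h1).2 hr
    · exact absurd h1 hr.ne
    · rw [mAdj_symm]; exact (hm0 j i h1).2 hr.symm
  simp only [leaf, List.any_eq_true] at hleaf
  obtain ⟨p, hp, hz⟩ := hleaf
  · right
    obtain ⟨hinj, hadj⟩ := hamList_ok p hp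
    have hstep : ∀ i, (extG \ R).Adj (p.2 i) (p.2 (i + 1)) := by
      intro i
      refine ⟨(hadj i).1, ?_⟩
      intro hr
      have h1 := hm1 _ _ hr
      have h2 := (hadj i).2
      obtain ⟨k, hb⟩ := mAdj_bit (p.2 i) (p.2 (i + 1))
      rw [hb] at h1 h2
      exact land_zero hz k h1 h2
    refine ⟨⟨p.2, ?_⟩, hinj⟩
    intro a b hab
    rw [cycleGraph_adj] at hab
    rcases hab with h | h
    · rw [sub_eq_iff_eq_add] at h
      rw [h, add_comm]
      exact (hstep b).symm
    · rw [sub_eq_iff_eq_add] at h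
      rw [h, add_comm]
      exact hstep a

theorem stmt_3 :
    (∃ F : SimpleGraph (Fin 7), F.edgeSet.ncard = 13 ∧
      Arrows F (pathGraph 3) (cycleGraph 7)) ∧
    (∀ (V : Type) [Fintype V] (F : SimpleGraph V), Fintype.card V = 7 →
      F.edgeSet.ncard < 13 → ¬ Arrows F (pathGraph 3) (cycleGraph 7)) :=
  ⟨⟨extG, ext_card, ext_arrows⟩, fun V _ F hV hF => lower V F hV hF⟩
end

section
/- For every even integer n ≥ 12, the restricted size Ramsey number satisfies r*(P_3, C_n) ≤ 2n − 2; that is, there exists a simple graph F on n vertices with 2n − 2 edges such that F → (P_3, C_n). -/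
open SimpleGraph

/-- Adjacency coming from a list of (ordered) edges. -/
def LAdj (L : List (ℕ × ℕ)) (x y : ℕ) : Prop := (x, y) ∈ L ∨ (y, x) ∈ L

/-- The chain: a seven-vertex gadget followed by `j` further layers of size two. -/
def chainL : ℕ → List (ℕ × ℕ)
  | 0 => [(0,3),(1,3),(2,3),(0,4),(1,4),(2,4),(0,5),(1,5),(2,5),(0,6),(1,6)]
  | j + 1 => [(5+2*j,7+2*j),(5+2*j,8+2*j),(6+2*j,7+2*j),(6+2*j,8+2*j)] ++ chainL j

/-- The closing gadget glued on the last layer. -/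
def closeL (j : ℕ) : List (ℕ × ℕ) :=
  [(5+2*j,7+2*j),(5+2*j,8+2*j),(5+2*j,9+2*j),(6+2*j,7+2*j),(6+2*j,8+2*j),
   (7+2*j,10+2*j),(8+2*j,10+2*j),(9+2*j,10+2*j),(7+2*j,11+2*j),(8+2*j,11+2*j),(9+2*j,11+2*j)]

def fullL (j : ℕ) : List (ℕ × ℕ) := closeL j ++ chainL j

lemma chainL_lt (j : ℕ) : ∀ e ∈ chainL j, e.1 < e.2 ∧ e.2 < 7 + 2 * j := by
  induction j with
  | zero => decide
  | succ j ih =>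
    intro e he
    simp only [chainL, List.mem_append, List.mem_cons, List.not_mem_nil, or_false] at he
    rcases he with (rfl | rfl | rfl | rfl) | he
    · simp <;> omega
    · simp <;> omega
    · simp <;> omega
    · simp <;> omega
    · have := ih e he
      omega

lemma chainL_nodup (j : ℕ) : (chainL j).Nodup := by
  induction j with
  | zero => decide
  | succ j ih =>
    rw [chainL, List.nodup_append']
    refine ⟨by simp, ih, ?_⟩
    intro e he he'
    have := chainL_lt j e he'
    simp only [List.mem_cons, List.not_mem_nil, or_false] at he
    rcases he with (rfl | rfl | rfl | rfl) <;> simp at this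

lemma chainL_length (j : ℕ) : (chainL j).length = 11 + 4 * j := by
  induction j with
  | zero => rfl
  | succ j ih => simp [chainL, ih]; omega

lemma fullL_lt (j : ℕ) : ∀ e ∈ fullL j, e.1 < e.2 ∧ e.2 < 12 + 2 * j := by
  intro e he
  simp only [fullL, closeL, List.mem_append, List.mem_cons, List.not_mem_nil, or_false] at he
  rcases he with (rfl | rfl | rfl | rfl | rfl | rfl | rfl | rfl | rfl | rfl | rfl) | he
  on_goal 12 => have := chainL_lt j e he; omega
  all_goals simp

lemma fullL_nodup (j : ℕ) : (fullL j).Nodup := by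
  rw [fullL, List.nodup_append']
  refine ⟨by simp [closeL], chainL_nodup j, ?_⟩
  intro e he he'
  have := chainL_lt j e he'
  simp only [closeL, List.mem_cons, List.not_mem_nil, or_false] at he
  rcases he with (rfl | rfl | rfl | rfl | rfl | rfl | rfl | rfl | rfl | rfl | rfl) <;>
    simp at this

lemma fullL_length (j : ℕ) : (fullL j).length = 22 + 4 * j := by
  simp [fullL, closeL, chainL_length]; omega

/-- The graph on `Fin n` given by an edge list. -/
def listGraph (n : ℕ) (L : List (ℕ × ℕ)) (h : ∀ e ∈ L, e.1 < e.2 ∧ e.2 < n) :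
    SimpleGraph (Fin n) where
  Adj x y := LAdj L x y
  symm := ⟨fun _ _ hxy => Or.symm hxy⟩
  loopless := ⟨fun x hx => by
    rcases hx with hx | hx <;> exact absurd (h _ hx).1 (lt_irrefl _)⟩

lemma listGraph_ncard (n : ℕ) (L : List (ℕ × ℕ)) (h : ∀ e ∈ L, e.1 < e.2 ∧ e.2 < n)
    (hnd : L.Nodup) : (listGraph n L h).edgeSet.ncard = L.length := by
  classical
  have hinj : Function.Injective (Sym2.map (Fin.val : Fin n → ℕ)) :=
    Sym2.map.injective Fin.val_injective
  rw [← Set.ncard_image_of_injective _ hinj]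
  have hs : Set.image (Sym2.map (Fin.val : Fin n → ℕ)) (listGraph n L h).edgeSet
      = ((L.toFinset.image (fun e => s(e.1, e.2)) : Finset (Sym2 ℕ)) : Set (Sym2 ℕ)) := by
    ext z
    simp only [Set.mem_image, Finset.coe_image, List.coe_toFinset, Set.mem_ofPred_eq]
    constructor
    · rintro ⟨w, hw, rfl⟩
      induction w using Sym2.ind with
      | _ x y =>
        rcases hw with hw | hw
        · exact ⟨_, hw, rfl⟩
        · exact ⟨_, hw, Sym2.eq_swap⟩
    · rintro ⟨⟨a, b⟩, he, rfl⟩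
      have := h _ he
      simp only at this
      exact ⟨s(⟨a, by omega⟩, ⟨b, by omega⟩), Or.inl he, rfl⟩
  rw [hs, Set.ncard_coe_finset, Finset.card_image_of_injOn, List.toFinset_card_of_nodup hnd]
  rintro ⟨a, b⟩ he ⟨c, d⟩ he' heq
  simp only [List.coe_toFinset, Set.mem_ofPred_eq] at he he'
  have h1 := h _ he
  have h2 := h _ he'
  simp only [Sym2.eq_iff] at heq h1 h2
  simp only [Prod.mk.injEq]
  omega

/-- The gadget: after removing a matching there is still a spanning path from `b` to `c`. -/
lemma gadget {R B : ℕ → ℕ → Prop} (hs : ∀ x y, R x y → R y x)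
    (hm : ∀ x y z, R x y → R x z → y = z) (hBs : ∀ x y, B x y → B y x)
    (p q r x y b c : ℕ) (hnd : [p, q, r, x, y, b, c].Nodup)
    (h1 : ¬ R p x → B p x) (h2 : ¬ R q x → B q x) (h3 : ¬ R r x → B r x)
    (h4 : ¬ R p y → B p y) (h5 : ¬ R q y → B q y) (h6 : ¬ R r y → B r y)
    (h7 : ¬ R p b → B p b) (h8 : ¬ R q b → B q b) (h9 : ¬ R r b → B r b)
    (h10 : ¬ R p c → B p c) (h11 : ¬ R q c → B q c) :
    ∃ l : List ℕ, l.Perm [p, q, r, x, y] ∧ List.IsChain B (b :: (l ++ [c])) := by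
  have row : ∀ u v w : ℕ, v ≠ w → ¬ (R u v ∧ R u w) := fun u v w h h' => h (hm u v w h'.1 h'.2)
  have col : ∀ u v w : ℕ, v ≠ w → ¬ (R v u ∧ R w u) :=
    fun u v w h h' => h (hm u v w (hs _ _ h'.1) (hs _ _ h'.2))
  have main : (B b p ∧ B p x ∧ B x r ∧ B r y ∧ B y q ∧ B q c) ∨
      (B b p ∧ B p y ∧ B y r ∧ B r x ∧ B x q ∧ B q c) ∨
      (B b r ∧ B r x ∧ B x p ∧ B p y ∧ B y q ∧ B q c) ∨
      (B b r ∧ B r y ∧ B y p ∧ B p x ∧ B x q ∧ B q c) ∨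
      (B b q ∧ B q x ∧ B x r ∧ B r y ∧ B y p ∧ B p c) ∨
      (B b q ∧ B q y ∧ B y r ∧ B r x ∧ B x p ∧ B p c) ∨
      (B b r ∧ B r x ∧ B x q ∧ B q y ∧ B y p ∧ B p c) ∨
      (B b r ∧ B r y ∧ B y q ∧ B q x ∧ B x p ∧ B p c) := by
    simp only [List.nodup_cons, List.mem_cons, List.not_mem_nil, or_false, not_or] at hnd
    obtain ⟨⟨pq, pr, px, py, pb, pc⟩, ⟨qr, qx, qy, qb, qc⟩, ⟨rx, ry, rb, rc⟩,
      ⟨xy, xb, xc⟩, ⟨yb, yc⟩, bc, -⟩ := hnd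
    have a1 := row p x y xy
    have a2 := row p x b xb
    have a3 := row p x c xc
    have a4 := row p y b yb
    have a5 := row p y c yc
    have a6 := row p b c bc
    have b1 := row q x y xy
    have b2 := row q x b xb
    have b3 := row q x c xc
    have b4 := row q y b yb
    have b5 := row q y c yc
    have b6 := row q b c bc
    have c1 := row r x y xy
    have c2 := row r x b xb
    have c4 := row r y b yb
    have d1 := col x p q pq
    have d2 := col x p r pr
    have d3 := col x q r qr
    have e1 := col y p q pq
    have e2 := col y p r pr
    have e3 := col y q r qr
    have f1 := col b p q pq
    have f2 := col b p r pr
    have f3 := col b q r qr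
    have g1 := col c p q pq
    have k1 := hBs p x
    have k2 := hBs q x
    have k3 := hBs r x
    have k4 := hBs p y
    have k5 := hBs q y
    have k6 := hBs r y
    have k7 := hBs p b
    have k8 := hBs q b
    have k9 := hBs r b
    clear row col hs hm hBs pq pr px py pb pc qr qx qy qb qc rx ry rb rc xy xb xc yb yc bc
    by_cases R p x <;> by_cases R q x <;> by_cases R r x <;> simp_all only [not_true_eq_false, not_false_eq_true, true_and, and_true, false_and, and_false, forall_const] <;> grind
  have perm : ∀ l : List ℕ, (∀ a, l.count a = [p, q, r, x, y].count a) →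
      l.Perm [p, q, r, x, y] := fun l h => List.perm_iff_count.2 h
  rcases main with h | h | h | h | h | h | h | h
  · exact ⟨[p, x, r, y, q], perm _ (by intro a; simp [List.count_cons]; omega), by simpa using h⟩
  · exact ⟨[p, y, r, x, q], perm _ (by intro a; simp [List.count_cons]; omega), by simpa using h⟩
  · exact ⟨[r, x, p, y, q], perm _ (by intro a; simp [List.count_cons]; omega), by simpa using h⟩
  · exact ⟨[r, y, p, x, q], perm _ (by intro a; simp [List.count_cons]; omega), by simpa using h⟩
  · exact ⟨[q, x, r, y, p], perm _ (by intro a; simp [List.count_cons]; omega), by simpa using h⟩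
  · exact ⟨[q, y, r, x, p], perm _ (by intro a; simp [List.count_cons]; omega), by simpa using h⟩
  · exact ⟨[r, x, q, y, p], perm _ (by intro a; simp [List.count_cons]; omega), by simpa using h⟩
  · exact ⟨[r, y, q, x, p], perm _ (by intro a; simp [List.count_cons]; omega), by simpa using h⟩

lemma chain_path {R B : ℕ → ℕ → Prop} (hs : ∀ x y, R x y → R y x)
    (hm : ∀ x y z, R x y → R x z → y = z) (hBs : ∀ x y, B x y → B y x) (j : ℕ)
    (hB : ∀ e ∈ chainL j, ¬ R e.1 e.2 → B e.1 e.2) :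
    ∃ l : List ℕ, ((5 + 2 * j) :: (l ++ [6 + 2 * j])).Perm (List.range (7 + 2 * j)) ∧
      List.IsChain B ((5 + 2 * j) :: (l ++ [6 + 2 * j])) := by
  induction j with
  | zero =>
    simp only [chainL, List.forall_mem_cons] at hB
    obtain ⟨h1, h2, h3, h4, h5, h6, h7, h8, h9, h10, h11, -⟩ := hB
    obtain ⟨l, hl, hc⟩ := gadget hs hm hBs 0 1 2 3 4 5 6 (by decide) h1 h2 h3 h4 h5 h6 h7 h8 h9
      h10 h11
    refine ⟨l, ?_, hc⟩
    refine ((hl.append_right [6]).cons 5).trans (by decide)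
  | succ j ih =>
    rw [chainL] at hB
    obtain ⟨l, hl, hc⟩ := ih (fun e he => hB e (List.mem_append_right _ he))
    have g1 := hB (5+2*j,7+2*j) (by simp)
    have g2 := hB (5+2*j,8+2*j) (by simp)
    have g3 := hB (6+2*j,7+2*j) (by simp)
    have g4 := hB (6+2*j,8+2*j) (by simp)
    simp only at g1 g2 g3 g4
    have e5 : 5 + 2 * (j + 1) = 7 + 2 * j := by ring
    have e6 : 6 + 2 * (j + 1) = 8 + 2 * j := by ring
    have e7 : List.range (7 + 2 * (j + 1)) = List.range (7 + 2 * j) ++ [7 + 2 * j, 8 + 2 * j] := by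
      rw [show 7 + 2 * (j + 1) = (7 + 2 * j + 1) + 1 by ring, List.range_succ, List.range_succ]
      simp; omega
    rw [e5, e6, e7]
    have hcases : (B (5+2*j) (7+2*j) ∧ B (6+2*j) (8+2*j)) ∨
        (B (5+2*j) (8+2*j) ∧ B (6+2*j) (7+2*j)) := by
      have n1 : ¬ (R (5+2*j) (7+2*j) ∧ R (5+2*j) (8+2*j)) := fun h => by
        have := hm _ _ _ h.1 h.2; omega
      have n2 : ¬ (R (6+2*j) (7+2*j) ∧ R (6+2*j) (8+2*j)) := fun h => by
        have := hm _ _ _ h.1 h.2; omega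
      have n3 : ¬ (R (5+2*j) (7+2*j) ∧ R (6+2*j) (7+2*j)) := fun h => by
        have := hm _ _ _ (hs _ _ h.1) (hs _ _ h.2); omega
      have n4 : ¬ (R (5+2*j) (8+2*j) ∧ R (6+2*j) (8+2*j)) := fun h => by
        have := hm _ _ _ (hs _ _ h.1) (hs _ _ h.2); omega
      tauto
    have perm : ∀ M : List ℕ, M.Perm (List.range (7 + 2 * j)) →
        ((7 + 2 * j) :: (M ++ [8 + 2 * j])).Perm
          (List.range (7 + 2 * j) ++ [7 + 2 * j, 8 + 2 * j]) := by
      intro M hM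
      have : ((7 + 2 * j) :: (M ++ [8 + 2 * j])).Perm (M ++ [7 + 2 * j, 8 + 2 * j]) :=
        List.perm_middle.symm
      exact this.trans (hM.append_right _)
    rcases hcases with ⟨u, v⟩ | ⟨u, v⟩
    · refine ⟨(5 + 2 * j) :: (l ++ [6 + 2 * j]), perm _ hl, ?_⟩
      rw [List.cons_append, List.isChain_cons_cons]
      refine ⟨hBs _ _ u, ?_⟩
      rw [← List.cons_append, List.isChain_append]
      refine ⟨hc, by simp, ?_⟩
      intro x hx y hy
      simp [List.getLast?_cons] at hx hy
      subst hx; subst hy; exact v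
    · have hc' := List.isChain_reverse.2 (hc.imp (fun a b h => hBs a b h))
      have hl' := (List.reverse_perm _).trans hl
      have er : ((5 + 2 * j) :: (l ++ [6 + 2 * j])).reverse =
        (6 + 2 * j) :: (l.reverse ++ [5 + 2 * j]) := by simp
      rw [er] at hc' hl'
      refine ⟨(6 + 2 * j) :: (l.reverse ++ [5 + 2 * j]), perm _ hl', ?_⟩
      rw [List.cons_append, List.isChain_cons_cons]
      refine ⟨hBs _ _ v, ?_⟩
      rw [← List.cons_append, List.isChain_append]
      refine ⟨hc', by simp, ?_⟩
      intro x hx y hy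
      simp [List.getLast?_cons] at hx hy
      subst hx; subst hy; exact u

/-- Closing up: a spanning path whose endpoints are adjacent. -/
lemma full_cycle {R B : ℕ → ℕ → Prop} (hs : ∀ x y, R x y → R y x)
    (hm : ∀ x y z, R x y → R x z → y = z) (hBs : ∀ x y, B x y → B y x) (j : ℕ)
    (hB : ∀ e ∈ fullL j, ¬ R e.1 e.2 → B e.1 e.2) :
    ∃ l : List ℕ, l.Perm (List.range (12 + 2 * j)) ∧
      List.IsChain B (l ++ [5 + 2 * j]) ∧ l.head? = some (5 + 2 * j) := by
  rw [fullL] at hB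
  obtain ⟨l, hl, hc⟩ := chain_path hs hm hBs j (fun e he => hB e (List.mem_append_right _ he))
  have hB' := fun e he => hB e (List.mem_append_left _ he)
  simp only [closeL, List.forall_mem_cons] at hB'
  obtain ⟨h1, h2, h3, h4, h5, h6, h7, h8, h9, h10, h11, -⟩ := hB'
  have sw : ∀ x y, (¬ R x y → B x y) → (¬ R y x → B y x) := fun x y h h' =>
    hBs _ _ (h (fun h'' => h' (hs _ _ h'')))
  obtain ⟨k, hk, hkc⟩ := gadget hs hm hBs (7+2*j) (8+2*j) (9+2*j) (10+2*j) (11+2*j) (5+2*j) (6+2*j)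
    (by simp) h6 h7 h8 h9 h10 h11 (sw _ _ h1) (sw _ _ h2) (sw _ _ h3) (sw _ _ h4) (sw _ _ h5)
  have hkc' := List.isChain_reverse.2 (hkc.imp (fun a b h => hBs a b h))
  have er : ((5 + 2 * j) :: (k ++ [6 + 2 * j])).reverse =
    (6 + 2 * j) :: (k.reverse ++ [5 + 2 * j]) := by simp
  rw [er] at hkc'
  refine ⟨((5 + 2 * j) :: (l ++ [6 + 2 * j])) ++ k.reverse, ?_, ?_, by simp⟩
  · have e7 : List.range (12 + 2 * j) =
        List.range (7 + 2 * j) ++ [7 + 2 * j, 8 + 2 * j, 9 + 2 * j, 10 + 2 * j, 11 + 2 * j] := by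
      rw [show 12 + 2 * j = (7 + 2 * j + 1 + 1 + 1 + 1) + 1 by ring, List.range_succ,
        List.range_succ, List.range_succ, List.range_succ, List.range_succ]
      simp; omega
    rw [e7]
    exact hl.append ((List.reverse_perm _).trans hk)
  · have e : ((5 + 2 * j) :: (l ++ [6 + 2 * j])) ++ k.reverse ++ [5 + 2 * j] =
        ((5 + 2 * j) :: l) ++ ((6 + 2 * j) :: (k.reverse ++ [5 + 2 * j])) := by simp
    rw [e]
    have e2 : (5 + 2 * j) :: (l ++ [6 + 2 * j]) = ((5 + 2 * j) :: l) ++ [6 + 2 * j] := by simp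
    rw [e2] at hc
    rw [List.isChain_split]
    exact ⟨hc, hkc'⟩

lemma contains_cycle (n : ℕ) (hn : 3 ≤ n) (G : SimpleGraph (Fin n)) (B : ℕ → ℕ → Prop)
    (hB : ∀ x y : Fin n, B x y → G.Adj x y) (a : ℕ) (l : List ℕ) (hl : l.Perm (List.range n))
    (hc : List.IsChain B (l ++ [a])) (hh : l.head? = some a) :
    Contains G (cycleGraph n) := by
  have hlen : l.length = n := by simpa using hl.length_eq
  have hnd : l.Nodup := hl.nodup_iff.2 List.nodup_range
  have hlt : ∀ i (hi : i < l.length), l[i] < n := fun i hi =>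
    List.mem_range.1 (hl.mem_iff.1 (List.getElem_mem hi))
  let f : Fin n → Fin n := fun i => ⟨l[i.1]'(by omega), hlt _ _⟩
  have hstep : ∀ i j : Fin n, (j.1 = i.1 + 1 ∨ (i.1 = n - 1 ∧ j.1 = 0)) → G.Adj (f i) (f j) := by
    intro i j hij
    apply hB
    rw [List.isChain_iff_getElem] at hc
    have := hc i.1 (by simp; omega)
    rw [List.getElem_append_left (by omega)] at this
    rcases hij with hij | ⟨hi, hj⟩
    · rw [List.getElem_append_left (by omega)] at this
      simpa [f, hij] using this
    · rw [List.getElem_append_right (by omega)] at this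
      have h0 : l[0]'(by omega) = a := by
        rw [List.head?_eq_getElem?, List.getElem?_eq_some_iff] at hh
        exact hh.2
      simp only [f, hj, h0]
      simpa using this
  have hval : ∀ u v : Fin n, u.1 = (v.1 + 1) % n → (u.1 = v.1 + 1 ∨ (v.1 = n - 1 ∧ u.1 = 0)) := by
    intro u v h
    rcases Nat.lt_or_ge (v.1 + 1) n with h' | h'
    · left; rwa [Nat.mod_eq_of_lt h'] at h
    · right
      have : v.1 + 1 = n := by omega
      rw [this, Nat.mod_self] at h
      omega
  refine ⟨⟨f, ?_⟩, ?_⟩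
  · intro u v huv
    obtain ⟨m, rfl⟩ : ∃ m, n = m + 2 := ⟨n - 2, by omega⟩
    rw [cycleGraph_adj] at huv
    rcases huv with h | h
    · have : u = v + 1 := by rw [← h]; abel
      exact (hstep v u (hval u v (by rw [this, Fin.val_add]; simp))).symm
    · have : v = u + 1 := by rw [← h]; abel
      exact (hstep u v (hval v u (by rw [this, Fin.val_add]; simp)))
  · intro u v huv
    have : l[u.1]'(by omega) = l[v.1]'(by omega) := congrArg Fin.val huv
    exact Fin.ext ((hnd.getElem_inj_iff).1 this)

theorem stmt_4 (n : ℕ) (hn : 12 ≤ n) (he : Even n) :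
    ∃ F : SimpleGraph (Fin n), F.edgeSet.ncard = 2 * n - 2 ∧
      Arrows F (pathGraph 3) (cycleGraph n) := by
  obtain ⟨j, rfl⟩ : ∃ j, n = 12 + 2 * j := by
    obtain ⟨k, rfl⟩ := he
    exact ⟨k - 6, by omega⟩
  refine ⟨listGraph _ (fullL j) (fullL_lt j), ?_, ?_⟩
  · rw [listGraph_ncard _ _ _ (fullL_nodup j), fullL_length]; omega
  intro R hR
  by_cases hm : ∀ x y z, R.Adj x y → R.Adj x z → y = z
  · right
    let R' : ℕ → ℕ → Prop := fun x y => ∃ (hx : x < 12 + 2 * j) (hy : y < 12 + 2 * j),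
      R.Adj ⟨x, hx⟩ ⟨y, hy⟩
    let B : ℕ → ℕ → Prop := fun x y => LAdj (fullL j) x y ∧ ¬ R' x y
    have hs : ∀ x y, R' x y → R' y x := fun x y ⟨hx, hy, h⟩ => ⟨hy, hx, h.symm⟩
    obtain ⟨l, hl, hc, hh⟩ := full_cycle (R := R') (B := B) hs
      (fun x y z ⟨hx, hy, h⟩ ⟨_, hz, h'⟩ => congrArg Fin.val (hm _ _ _ h h'))
      (fun x y h => ⟨h.1.symm, fun h' => h.2 (hs _ _ h')⟩) j
      (fun e he h => ⟨Or.inl he, h⟩)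
    refine contains_cycle _ (by omega) _ B ?_ _ l hl hc hh
    intro x y hxy
    rw [sdiff_adj]
    exact ⟨hxy.1, fun h => hxy.2 ⟨x.2, y.2, h⟩⟩
  · left
    push Not at hm
    obtain ⟨x, y, z, hy, hz, hne⟩ := hm
    refine ⟨⟨![y, x, z], ?_⟩, ?_⟩
    · intro u v huv
      rw [pathGraph_adj] at huv
      fin_cases u <;> fin_cases v <;> simp_all [R.adj_comm]
    · intro u v huv
      have := hy.ne
      have := hz.ne
      fin_cases u <;> fin_cases v <;> simp_all
end

section
/- Let n ≥ 12 be even, let t = (n − 2)/2, and let F_n' be the simple graph with vertex set {x, y} ∪ {u_1, ..., u_t} ∪ {v_1, ..., v_t} and edge set {x u_1, x v_1, u_t y, v_t y, v_{t−2} y} ∪ {u_i u_{i+1}, v_i v_{i+1}, v_i u_{i+1}, u_i v_{i+1} : 1 ≤ i ≤ t − 1} (that is, the graph F_n of the construction with the edge x u_3 deleted). Then F_n' has n vertices and 2n − 3 edges, and F_n' → (P_3, P_n). -/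
open SimpleGraph

/-- Vertex type of the construction: `x`, `y`, and `uᵢ`, `vᵢ` for `i : Fin t`
(`uᵢ` of the paper, `1 ≤ i ≤ t`, is `u ⟨i - 1⟩`). -/
abbrev Vt (t : ℕ) := (Unit ⊕ Unit) ⊕ (Fin t ⊕ Fin t)

def vx {t : ℕ} : Vt t := Sum.inl (Sum.inl ())
def vy {t : ℕ} : Vt t := Sum.inl (Sum.inr ())
def vu {t : ℕ} (i : Fin t) : Vt t := Sum.inr (Sum.inl i)
def vv {t : ℕ} (i : Fin t) : Vt t := Sum.inr (Sum.inr i)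

/-- Edges `uᵢuᵢ₊₁, vᵢvᵢ₊₁, vᵢuᵢ₊₁, uᵢvᵢ₊₁` for `1 ≤ i ≤ t - 1` (0-based here). -/
def ladderEdges (t : ℕ) : Set (Sym2 (Vt t)) :=
  { e | ∃ i j : Fin t, (j : ℕ) = (i : ℕ) + 1 ∧
      (e = s(vu i, vu j) ∨ e = s(vv i, vv j) ∨ e = s(vv i, vu j) ∨ e = s(vu i, vv j)) }

/-- The graph `Fₙ'`: the construction with the extra edges
`x u₁, x v₁, uₜ y, vₜ y, vₜ₋₂ y` (the edge `x u₃` being deleted). -/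
def Fgraph' (t : ℕ) : SimpleGraph (Vt t) :=
  fromEdgeSet
    ({ e | ∃ i : Fin t,
        ((i : ℕ) = 0 ∧ (e = s(vx, vu i) ∨ e = s(vx, vv i))) ∨
        ((i : ℕ) = t - 1 ∧ (e = s(vu i, vy) ∨ e = s(vv i, vy))) ∨
        ((i : ℕ) = t - 3 ∧ e = s(vv i, vy)) } ∪ ladderEdges t)

/-- Edge enumeration. -/
def edgeMap (t : ℕ) (h : 5 ≤ t) : (Fin (t-1) × Fin 4) ⊕ Fin 5 → Sym2 (Vt t)
  | Sum.inl (i, 0) => s(vu ⟨i, by omega⟩, vu ⟨i+1, by omega⟩)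
  | Sum.inl (i, 1) => s(vv ⟨i, by omega⟩, vv ⟨i+1, by omega⟩)
  | Sum.inl (i, 2) => s(vv ⟨i, by omega⟩, vu ⟨i+1, by omega⟩)
  | Sum.inl (i, 3) => s(vu ⟨i, by omega⟩, vv ⟨i+1, by omega⟩)
  | Sum.inr 0 => s(vx, vu ⟨0, by omega⟩)
  | Sum.inr 1 => s(vx, vv ⟨0, by omega⟩)
  | Sum.inr 2 => s(vu ⟨t-1, by omega⟩, vy)
  | Sum.inr 3 => s(vv ⟨t-1, by omega⟩, vy)
  | Sum.inr 4 => s(vv ⟨t-3, by omega⟩, vy)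

theorem edgeMap_inj (t : ℕ) (h : 5 ≤ t) : Function.Injective (edgeMap t h) := by
  rintro (⟨i, a⟩ | a) (⟨j, b⟩ | b) hab <;> fin_cases a <;> fin_cases b <;>
    simp [edgeMap, vx, vy, vu, vv, Fin.ext_iff] at hab ⊢ <;> omega

theorem edgeMap_range (t : ℕ) (h : 5 ≤ t) : Set.range (edgeMap t h) = (Fgraph' t).edgeSet := by
  ext e
  constructor
  · rintro ⟨(⟨i, a⟩ | a), rfl⟩
    · have hi := i.2
      rw [Fgraph', edgeSet_fromEdgeSet]
      refine ⟨Or.inr ⟨⟨i, by omega⟩, ⟨i+1, by omega⟩, rfl, ?_⟩, ?_⟩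
      · fin_cases a <;> simp [edgeMap]
      · fin_cases a <;> simp [edgeMap, vu, vv, Fin.ext_iff]
    · rw [Fgraph', edgeSet_fromEdgeSet]
      fin_cases a
      · exact ⟨Or.inl ⟨⟨0, by omega⟩, by simp [edgeMap]⟩, by simp [edgeMap, vx, vu]⟩
      · exact ⟨Or.inl ⟨⟨0, by omega⟩, by simp [edgeMap]⟩, by simp [edgeMap, vx, vv]⟩
      · exact ⟨Or.inl ⟨⟨t-1, by omega⟩, by simp [edgeMap]⟩, by simp [edgeMap, vy, vu]⟩
      · exact ⟨Or.inl ⟨⟨t-1, by omega⟩, by simp [edgeMap]⟩, by simp [edgeMap, vy, vv]⟩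
      · exact ⟨Or.inl ⟨⟨t-3, by omega⟩, by simp [edgeMap]⟩, by simp [edgeMap, vy, vv]⟩
  · rw [Fgraph', edgeSet_fromEdgeSet]
    rintro ⟨⟨⟨i, hi⟩, h1 | h1 | h1⟩ | ⟨⟨i, hi⟩, ⟨j, hj⟩, hij, h1⟩, -⟩
    · obtain ⟨h0, h1⟩ := h1
      simp only at h0
      subst h0
      rcases h1 with rfl | rfl
      · exact ⟨Sum.inr 0, rfl⟩
      · exact ⟨Sum.inr 1, rfl⟩
    · obtain ⟨h0, h1⟩ := h1
      simp only at h0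
      subst h0
      rcases h1 with rfl | rfl
      · exact ⟨Sum.inr 2, rfl⟩
      · exact ⟨Sum.inr 3, rfl⟩
    · obtain ⟨h0, rfl⟩ := h1
      simp only at h0
      subst h0
      exact ⟨Sum.inr 4, rfl⟩
    · simp only at hij
      subst hij
      rcases h1 with rfl | rfl | rfl | rfl
      · exact ⟨Sum.inl (⟨i, by omega⟩, 0), rfl⟩
      · exact ⟨Sum.inl (⟨i, by omega⟩, 1), rfl⟩
      · exact ⟨Sum.inl (⟨i, by omega⟩, 2), rfl⟩
      · exact ⟨Sum.inl (⟨i, by omega⟩, 3), rfl⟩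

theorem edge_count (t : ℕ) (h : 5 ≤ t) : (Fgraph' t).edgeSet.ncard = 4 * (t - 1) + 5 := by
  rw [← edgeMap_range t h, ← Set.image_univ, Set.ncard_image_of_injective _ (edgeMap_inj t h),
    Set.ncard_univ]
  simp
  omega

/-- A duplicate-free chain gives a path. -/
theorem contains_of_list {α : Type*} (G : SimpleGraph α) (l : List α) (hc : l.IsChain G.Adj)
    (hd : l.Nodup) (n : ℕ) (hl : l.length = n) : Contains G (pathGraph n) := by
  subst hl
  refine ⟨⟨fun i => l.get i, ?_⟩, List.nodup_iff_injective_get.1 hd⟩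
  intro a b hab
  rw [List.isChain_iff_getElem] at hc
  rw [pathGraph_adj] at hab
  rcases hab with hab | hab
  · have := hc a (by omega)
    simpa [hab] using this
  · have := (hc b (by omega)).symm
    simpa [hab] using this

theorem matching_of_not {α : Type*} (R : SimpleGraph α) (h : ¬ Contains R (pathGraph 3))
    (a b c : α) (hb : R.Adj a b) (hc : R.Adj a c) : b = c := by
  by_contra hne
  apply h
  have := hb.ne
  have := hc.ne
  refine contains_of_list R [b, a, c] ?_ ?_ 3 rfl
  · simp [hb.symm, hc]
  · simp; tauto

/-- Level of a vertex. -/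
def level {t : ℕ} : Vt t → ℕ
  | Sum.inl (Sum.inl _) => 0
  | Sum.inl (Sum.inr _) => t + 1
  | Sum.inr (Sum.inl i) => i + 1
  | Sum.inr (Sum.inr i) => i + 1

@[simp] theorem level_x {t : ℕ} : level (vx : Vt t) = 0 := rfl
@[simp] theorem level_y {t : ℕ} : level (vy : Vt t) = t + 1 := rfl
@[simp] theorem level_u {t : ℕ} (i : Fin t) : level (vu i) = i + 1 := rfl
@[simp] theorem level_v {t : ℕ} (i : Fin t) : level (vv i) = i + 1 := rfl
@[simp] theorem u_ne_v {t : ℕ} (i j : Fin t) : (vu i) ≠ vv j := by simp [vu, vv]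
@[simp] theorem v_ne_u {t : ℕ} (i j : Fin t) : (vv i) ≠ vu j := by simp [vu, vv]

theorem adj_ladder {t : ℕ} (i j : Fin t) (h : (j : ℕ) = i + 1) :
    (Fgraph' t).Adj (vu i) (vu j) ∧ (Fgraph' t).Adj (vv i) (vv j) ∧
    (Fgraph' t).Adj (vv i) (vu j) ∧ (Fgraph' t).Adj (vu i) (vv j) := by
  have hij : i ≠ j := by rintro rfl; omega
  simp only [Fgraph', fromEdgeSet_adj]
  refine ⟨⟨Or.inr ⟨i, j, h, by simp⟩, by simpa [vu] using hij⟩,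
    ⟨Or.inr ⟨i, j, h, by simp⟩, by simpa [vv] using hij⟩,
    ⟨Or.inr ⟨i, j, h, by simp⟩, by simp⟩, ⟨Or.inr ⟨i, j, h, by simp⟩, by simp⟩⟩

theorem adj_x {t : ℕ} (i : Fin t) (h : (i : ℕ) = 0) :
    (Fgraph' t).Adj vx (vu i) ∧ (Fgraph' t).Adj vx (vv i) := by
  simp only [Fgraph', fromEdgeSet_adj]
  exact ⟨⟨Or.inl ⟨i, Or.inl ⟨h, by simp⟩⟩, by simp [vx, vu]⟩,
    ⟨Or.inl ⟨i, Or.inl ⟨h, by simp⟩⟩, by simp [vx, vv]⟩⟩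

theorem adj_y {t : ℕ} (i : Fin t) (h : (i : ℕ) = t - 1) :
    (Fgraph' t).Adj (vu i) vy ∧ (Fgraph' t).Adj (vv i) vy := by
  simp only [Fgraph', fromEdgeSet_adj]
  exact ⟨⟨Or.inl ⟨i, Or.inr (Or.inl ⟨h, by simp⟩)⟩, by simp [vy, vu]⟩,
    ⟨Or.inl ⟨i, Or.inr (Or.inl ⟨h, by simp⟩)⟩, by simp [vy, vv]⟩⟩

theorem adj_y' {t : ℕ} (i : Fin t) (h : (i : ℕ) = t - 3) : (Fgraph' t).Adj (vv i) vy := by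
  simp only [Fgraph', fromEdgeSet_adj]
  exact ⟨Or.inl ⟨i, Or.inr (Or.inr ⟨h, by simp⟩)⟩, by simp [vy, vv]⟩

/-- Two disjoint blue strands covering levels up to `k + 1`. -/
theorem strands {t : ℕ} (R : SimpleGraph (Vt t))
    (hR : ∀ a b c, R.Adj a b → R.Adj a c → b = c) (k : ℕ) (hk : k < t) :
    ∃ A B : List (Vt t), (vu ⟨k, hk⟩ :: A).IsChain (Fgraph' t \ R).Adj ∧
      (vv ⟨k, hk⟩ :: B).IsChain (Fgraph' t \ R).Adj ∧
      ((vu ⟨k, hk⟩ :: A) ++ (vv ⟨k, hk⟩ :: B)).Nodup ∧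
      A.length + B.length = 2 * k + 1 ∧
      (∀ z ∈ A, level z ≤ k + 1) ∧ (∀ z ∈ B, level z ≤ k + 1) := by
  induction k with
  | zero =>
    obtain ⟨h1, h2⟩ := adj_x (t := t) ⟨0, hk⟩ rfl
    by_cases hu : R.Adj vx (vu ⟨0, hk⟩)
    · have hv : ¬ R.Adj vx (vv ⟨0, hk⟩) := fun hv => u_ne_v _ _ (hR _ _ _ hu hv)
      refine ⟨[], [vx], by simp, ?_, ?_, by simp, by simp, by simp⟩
      · simp only [List.isChain_cons_cons, List.isChain_singleton, and_true]
        exact SimpleGraph.Adj.symm ⟨h2, hv⟩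
      · simp [vu, vv, vx]
    · refine ⟨[vx], [], ?_, by simp, ?_, by simp, by simp, by simp⟩
      · simp only [List.isChain_cons_cons, List.isChain_singleton, and_true]
        exact SimpleGraph.Adj.symm ⟨h1, hu⟩
      · simp [vu, vv, vx]
  | succ k ih =>
    have hk' : k < t := by omega
    obtain ⟨A, B, hA, hB, hd, hl, lA, lB⟩ := ih hk'
    obtain ⟨f1, f2, f3, f4⟩ := adj_ladder (t := t) ⟨k, hk'⟩ ⟨k+1, hk⟩ rfl
    have nU : ∀ w : Vt t, level w = k + 2 →
        w ∉ (vu ⟨k, hk'⟩ :: A) ∧ w ∉ (vv ⟨k, hk'⟩ :: B) := by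
      intro w hw
      constructor
      · intro hm
        rcases List.mem_cons.1 hm with rfl | hm
        · simp at hw
        · have := lA _ hm; omega
      · intro hm
        rcases List.mem_cons.1 hm with rfl | hm
        · simp at hw
        · have := lB _ hm; omega
    have nu := nU (vu ⟨k+1, hk⟩) (by simp)
    have nv := nU (vv ⟨k+1, hk⟩) (by simp)
    have lA' : ∀ z ∈ (vu ⟨k, hk'⟩ :: A), level z ≤ k + 1 + 1 := by
      intro z hz
      rcases List.mem_cons.1 hz with rfl | hz
      · simp
      · have := lA _ hz; omega
    have lB' : ∀ z ∈ (vv ⟨k, hk'⟩ :: B), level z ≤ k + 1 + 1 := by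
      intro z hz
      rcases List.mem_cons.1 hz with rfl | hz
      · simp
      · have := lB _ hz; omega
    have huv := u_ne_v (t := t) ⟨k+1, hk⟩ ⟨k+1, hk⟩
    by_cases hc : R.Adj (vu ⟨k, hk'⟩) (vu ⟨k+1, hk⟩) ∨ R.Adj (vv ⟨k, hk'⟩) (vv ⟨k+1, hk⟩)
    · have g3 : ¬ R.Adj (vv ⟨k, hk'⟩) (vu ⟨k+1, hk⟩) := by
        rintro h
        rcases hc with hc | hc
        · exact u_ne_v _ _ (hR _ _ _ hc.symm h.symm)
        · exact u_ne_v _ _ (hR _ _ _ h hc)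
      have g4 : ¬ R.Adj (vu ⟨k, hk'⟩) (vv ⟨k+1, hk⟩) := by
        rintro h
        rcases hc with hc | hc
        · exact u_ne_v _ _ (hR _ _ _ hc h)
        · exact u_ne_v _ _ (hR _ _ _ h.symm hc.symm)
      refine ⟨_ :: B, _ :: A, List.isChain_cons_cons.2 ⟨SimpleGraph.Adj.symm ⟨f3, g3⟩, hB⟩,
        List.isChain_cons_cons.2 ⟨SimpleGraph.Adj.symm ⟨f4, g4⟩, hA⟩, ?_, ?_, lB', lA'⟩
      · generalize vu ⟨k, hk'⟩ :: A = A' at *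
        generalize vv ⟨k, hk'⟩ :: B = B' at *
        grind
      · simp; omega
    · rw [not_or] at hc
      refine ⟨_ :: A, _ :: B, List.isChain_cons_cons.2 ⟨SimpleGraph.Adj.symm ⟨f1, hc.1⟩, hA⟩,
        List.isChain_cons_cons.2 ⟨SimpleGraph.Adj.symm ⟨f2, hc.2⟩, hB⟩, ?_, ?_, lA', lB'⟩
      · generalize vu ⟨k, hk'⟩ :: A = A' at *
        generalize vv ⟨k, hk'⟩ :: B = B' at *
        grind
      · simp; omega

/-- Glue the two strands with a gadget path `M` of higher levels. -/
theorem glue {t : ℕ} (R : SimpleGraph (Vt t))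
    (hR : ∀ a b c, R.Adj a b → R.Adj a c → b = c) (k : ℕ) (hk : k < t) (M : List (Vt t))
    (hM : (vu ⟨k, hk⟩ :: (M ++ [vv ⟨k, hk⟩])).IsChain (Fgraph' t \ R).Adj) (hd : M.Nodup)
    (hlv : ∀ z ∈ M, k + 1 < level z) (n : ℕ) (hn : n = M.length + 2 * k + 3) :
    Contains (Fgraph' t \ R) (pathGraph n) := by
  obtain ⟨A, B, hA, hB, hAB, hl, lA, lB⟩ := strands R hR k hk
  have dA : ∀ z ∈ M, z ∉ vu ⟨k, hk⟩ :: A := by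
    intro z hz hm
    have := hlv z hz
    rcases List.mem_cons.1 hm with rfl | hm
    · simp at this
    · have := lA _ hm; omega
  have dB : ∀ z ∈ M, z ∉ vv ⟨k, hk⟩ :: B := by
    intro z hz hm
    have := hlv z hz
    rcases List.mem_cons.1 hm with rfl | hm
    · simp at this
    · have := lB _ hm; omega
  refine contains_of_list _ ((vu ⟨k, hk⟩ :: A).reverse ++ (M ++ (vv ⟨k, hk⟩ :: B))) ?_ ?_ n ?_
  · have h1 : (M ++ (vv ⟨k, hk⟩ :: B)).IsChain (Fgraph' t \ R).Adj := by
      have := hM.tail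
      simp only [List.tail_cons] at this
      rw [List.isChain_append] at this ⊢
      exact ⟨this.1, hB, by simpa using this.2.2⟩
    rw [List.isChain_append]
    refine ⟨?_, h1, ?_⟩
    · rw [List.isChain_reverse]
      exact hA.imp fun _ _ h => h.symm
    · intro a ha b hb
      simp at ha
      subst ha
      cases M with
      | nil => simp at hM hb; subst hb; simpa using hM
      | cons m M => simp at hM hb; subst hb; simpa using hM.1
  · generalize vu ⟨k, hk⟩ :: A = A' at *
    generalize vv ⟨k, hk⟩ :: B = B' at *
    rw [List.nodup_append] at hAB ⊢
    rw [List.nodup_append]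
    simp only [List.mem_reverse, List.nodup_reverse, List.mem_append]
    grind
  · simp; omega

/-- The end gadget: `v y b c a d u` when `y a` is red. -/
theorem gadget_s7 {t : ℕ} (R : SimpleGraph (Vt t))
    (hR : ∀ a b c, R.Adj a b → R.Adj a c → b = c) (ht : 3 ≤ t) (a b : Vt t)
    (hab : a ≠ b) (la : level a = t) (lb : level b = t)
    (fa : ∀ c, level c = t - 1 → (Fgraph' t).Adj c a)
    (fb : ∀ c, level c = t - 1 → (Fgraph' t).Adj c b)
    (fby : (Fgraph' t).Adj b vy) (hr : R.Adj a vy) :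
    Contains (Fgraph' t \ R) (pathGraph (2 * t + 2)) := by
  have main : ∀ c d : Vt t, c ≠ d → level c = t - 1 → level d = t - 1 → ¬ R.Adj c b →
      ¬ R.Adj (vu ⟨t-3, by omega⟩) d → (Fgraph' t).Adj (vu ⟨t-3, by omega⟩) d →
      Contains (Fgraph' t \ R) (pathGraph (2 * t + 2)) := by
    intro c d hcd lc ld hcb hud fud
    have key : ∀ w, level w ≠ t + 1 → ¬ R.Adj w a := by
      intro w hw h
      have := hR _ _ _ hr h.symm
      subst this
      simp at hw
    have key2 : ∀ w, w ≠ a → ¬ R.Adj w vy := fun w hw h => hw (hR _ _ _ h.symm hr.symm)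
    refine glue R hR (t-3) (by omega) [d, a, c, b, vy] ?_ ?_ ?_ _ ?_
    · simp only [List.cons_append, List.nil_append, List.isChain_cons_cons,
        List.isChain_singleton, and_true]
      refine ⟨⟨fud, hud⟩, ⟨fa d ld, key _ (by omega)⟩,
        SimpleGraph.Adj.symm ⟨fa c lc, key _ (by omega)⟩, ⟨fb c lc, hcb⟩,
        ⟨fby, key2 _ hab.symm⟩, SimpleGraph.Adj.symm ⟨adj_y' _ rfl, key2 _ ?_⟩⟩
      intro e
      rw [← e] at la
      simp at la
      omega
    · have n1 : ∀ p q : Vt t, level p ≠ level q → p ≠ q := fun p q h e => h (by rw [e])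
      have := n1 d a (by omega)
      have := n1 d b (by omega)
      have := n1 c a (by omega)
      have := n1 c b (by omega)
      have := n1 d vy (by simp; omega)
      have := n1 a vy (by simp; omega)
      have := n1 c vy (by simp; omega)
      have := n1 b vy (by simp; omega)
      simp
      tauto
    · intro z hz
      simp at hz
      rcases hz with rfl | rfl | rfl | rfl | rfl
      all_goals first | omega | (simp; omega)
    · simp; omega
  obtain ⟨f1, f2, f3, f4⟩ := adj_ladder (t := t) ⟨t-3, by omega⟩ ⟨t-2, by omega⟩
    (by simp; omega)
  have l1 : level (vu (⟨t-2, by omega⟩ : Fin t)) = t - 1 := by simp; omega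
  have l2 : level (vv (⟨t-2, by omega⟩ : Fin t)) = t - 1 := by simp; omega
  have ne := u_ne_v (⟨t-2, by omega⟩ : Fin t) ⟨t-2, by omega⟩
  by_cases h : R.Adj (vu ⟨t-2, by omega⟩) b ∨ R.Adj (vu ⟨t-3, by omega⟩) (vv ⟨t-2, by omega⟩)
  · refine main (vv ⟨t-2, by omega⟩) (vu ⟨t-2, by omega⟩) ne.symm l2 l1 ?_ ?_ f1
    · intro h'
      rcases h with h | h
      · exact ne (hR _ _ _ h.symm h'.symm)
      · have := hR _ _ _ h' h.symm
        rw [this] at lb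
        simp at lb
        omega
    · intro h'
      rcases h with h | h
      · have := hR _ _ _ h h'.symm
        rw [this] at lb
        simp at lb
        omega
      · exact ne (hR _ _ _ h' h)
  · rw [not_or] at h
    exact main _ _ ne l1 l2 h.1 h.2 f4

theorem level_cases {t : ℕ} (c : Vt t) (k : ℕ) (hk : k < t) (h : level c = k + 1) :
    c = vu ⟨k, hk⟩ ∨ c = vv ⟨k, hk⟩ := by
  rcases c with (c | c) | (c | c) <;> simp [level] at h
  · omega
  · left; subst h; rfl
  · right; subst h; rfl

theorem stmt_7 (n t : ℕ) (hn : 12 ≤ n) (he : Even n) (ht : t = (n - 2) / 2) :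
    Fintype.card (Vt t) = n ∧ (Fgraph' t).edgeSet.ncard = 2 * n - 3 ∧
      Arrows (Fgraph' t) (pathGraph 3) (pathGraph n) := by
  obtain ⟨m, rfl⟩ := he
  have hm : m + m = 2 * t + 2 := by omega
  have h5 : 5 ≤ t := by omega
  rw [hm]
  refine ⟨by simp; omega, by rw [edge_count t h5]; omega, ?_⟩
  intro R _
  by_cases h3 : Contains R (pathGraph 3)
  · exact Or.inl h3
  right
  have hR := matching_of_not R h3
  obtain ⟨yu, yv⟩ := adj_y (t := t) ⟨t-1, by omega⟩ rfl
  obtain ⟨f1, f2, f3, f4⟩ := adj_ladder (t := t) ⟨t-2, by omega⟩ ⟨t-1, by omega⟩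
    (by simp; omega)
  have ne := u_ne_v (⟨t-1, by omega⟩ : Fin t) ⟨t-1, by omega⟩
  have l1 : level (vu (⟨t-1, by omega⟩ : Fin t)) = t := by simp; omega
  have l2 : level (vv (⟨t-1, by omega⟩ : Fin t)) = t := by simp; omega
  have fu : ∀ c, level c = t - 1 → (Fgraph' t).Adj c (vu ⟨t-1, by omega⟩) := by
    intro c hc
    rcases level_cases c (t-2) (by omega) (by omega) with e | e
    · rw [e]; exact f1
    · rw [e]; exact f3
  have fv : ∀ c, level c = t - 1 → (Fgraph' t).Adj c (vv ⟨t-1, by omega⟩) := by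
    intro c hc
    rcases level_cases c (t-2) (by omega) (by omega) with e | e
    · rw [e]; exact f4
    · rw [e]; exact f2
  by_cases hu : R.Adj (vu ⟨t-1, by omega⟩) vy
  · exact gadget_s7 R hR (by omega) _ _ ne l1 l2 fu fv yv hu
  by_cases hv : R.Adj (vv ⟨t-1, by omega⟩) vy
  · exact gadget_s7 R hR (by omega) _ _ ne.symm l2 l1 fv fu yu hv
  refine glue R hR (t-1) (by omega) [vy] ?_ (by simp) ?_ _ ?_
  · simp only [List.cons_append, List.nil_append, List.isChain_cons_cons,
      List.isChain_singleton, and_true]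
    exact ⟨⟨yu, hu⟩, SimpleGraph.Adj.symm ⟨yv, hv⟩⟩
  · simp; omega
  · simp; omega
end

section
/- The restricted size Ramsey number r*(P_3, C_8) equals 15: there exists a simple graph F on 8 vertices with 15 edges such that F → (P_3, C_8), and every simple graph on 8 vertices with fewer than 15 edges fails to arrow (P_3, C_8). -/
open SimpleGraph

namespace RStar

/-- Sum of eight values. -/
def sum8 (f : Fin 8 → ℕ) : ℕ := f 0 + f 1 + f 2 + f 3 + f 4 + f 5 + f 6 + f 7

theorem sum8_eq (f : Fin 8 → ℕ) : sum8 f = ∑ i, f i := (Fin.sum_univ_eight f).symm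

def all8 (f : Fin 8 → Bool) : Bool := f 0 && f 1 && f 2 && f 3 && f 4 && f 5 && f 6 && f 7

theorem all8_iff (f : Fin 8 → Bool) : all8 f = true ↔ ∀ i, f i = true := by
  simp [all8, Fin.forall_fin_succ, and_assoc]

def any8 (f : Fin 8 → Bool) : Bool := f 0 || f 1 || f 2 || f 3 || f 4 || f 5 || f 6 || f 7

theorem any8_iff (f : Fin 8 → Bool) : any8 f = true ↔ ∃ i, f i = true := by
  simp [any8, Fin.exists_fin_succ, or_assoc]

/-- A set of ordered pairs of vertices is stored as the bits of a number. -/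
def bt (E : ℕ) (u v : Fin 8) : Bool := E.testBit (8 * u.val + v.val)

def ins (E : ℕ) (u v : Fin 8) : ℕ :=
  E ||| (1 <<< (8 * u.val + v.val)) ||| (1 <<< (8 * v.val + u.val))

theorem bt_ins (E : ℕ) (u v a b : Fin 8) :
    bt (ins E u v) a b = true ↔ bt E a b = true ∨ (a = u ∧ b = v) ∨ (a = v ∧ b = u) := by
  have key : ∀ m n : ℕ, (1 <<< m).testBit n = true ↔ m = n := by
    intro m n
    rw [Nat.one_shiftLeft, Nat.testBit_two_pow]
    simp
  unfold bt ins
  rw [Nat.testBit_or, Nat.testBit_or, Bool.or_eq_true, Bool.or_eq_true, key, key, or_assoc]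
  have h1 : 8 * u.val + v.val = 8 * a.val + b.val ↔ (a = u ∧ b = v) := by
    rw [Fin.ext_iff, Fin.ext_iff]; omega
  have h2 : 8 * v.val + u.val = 8 * a.val + b.val ↔ (a = v ∧ b = u) := by
    rw [Fin.ext_iff, Fin.ext_iff]; omega
  rw [h1, h2]

/-- A Hamiltonian-cycle obstruction: labels, label `0` being the cut set. -/
theorem tough {V : Type} [Fintype V] (hV : Fintype.card V = 8) (F : SimpleGraph V)
    (l : V → ℕ) (z : ℕ) (hz : 1 ≤ z) (hcard : (Finset.univ.filter (fun v => l v = 0)).card ≤ z)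
    (hl : ∀ j < z + 1, ∃ v, l v = j + 1)
    (hm : ∀ u v w, F.Adj u v → l u ≠ 0 → l v ≠ 0 → l u ≠ l v →
      F.Adj u w → l w ≠ 0 → l u ≠ l w → v = w) :
    ¬ Arrows F (pathGraph 3) (cycleGraph 8) := by
  classical
  intro hA
  let R : SimpleGraph V :=
    { Adj := fun u v => F.Adj u v ∧ l u ≠ 0 ∧ l v ≠ 0 ∧ l u ≠ l v
      symm := ⟨fun u v h => ⟨h.1.symm, h.2.2.1, h.2.1, h.2.2.2.symm⟩⟩
      loopless := ⟨fun u h => h.2.2.2 rfl⟩ }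
  rcases hA R (fun u v h => h.1) with ⟨f, hf⟩ | ⟨f, hf⟩
  · have h1 : (pathGraph 3).Adj 1 0 := by simp [pathGraph_adj]
    have h2 : (pathGraph 3).Adj 1 2 := by simp [pathGraph_adj]
    have a1 := f.map_adj h1
    have a2 := f.map_adj h2
    have := hm _ _ _ a1.1 a1.2.1 a1.2.2.1 a1.2.2.2 a2.1 a2.2.2.1 a2.2.2.2
    exact absurd (hf this) (by decide)
  · have hb : Function.Bijective f :=
      (Fintype.bijective_iff_injective_and_card f).2 ⟨hf, by simp [hV]⟩
    have hadj : ∀ i : Fin 8, (F \ R).Adj (f i) (f (i + 1)) := by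
      intro i
      apply f.map_adj
      rw [cycleGraph_adj]
      right; simp
    have hstep : ∀ i : Fin 8, l (f i) ≠ 0 → l (f (i + 1)) ≠ 0 → l (f i) = l (f (i + 1)) := by
      intro i h0 h1
      by_contra h
      have := hadj i
      rw [SimpleGraph.sdiff_adj] at this
      exact this.2 ⟨this.1, h0, h1, h⟩
    have hex : ∀ j < z + 1, ∃ i : Fin 8, l (f i) = j + 1 ∧ l (f (i + 1)) = 0 := by
      intro j hj
      by_contra hno
      push Not at hno
      have hall : ∀ i : Fin 8, l (f i) = j + 1 → l (f (i + 1)) = j + 1 := by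
        intro i hi
        rw [← hstep i (by omega) (hno i hi), hi]
      obtain ⟨v, hv⟩ := hl j hj
      obtain ⟨i, rfl⟩ := hb.2 v
      have hn : ∀ n : ℕ, l (f (i + n • (1 : Fin 8))) = j + 1 := by
        intro n
        induction n with
        | zero => simpa using hv
        | succ n ih =>
          have := hall _ ih
          rw [succ_nsmul, ← add_assoc]; exact this
      obtain ⟨j', hj', hne⟩ : ∃ j' < z + 1, j' ≠ j := by
        by_cases h : j = 0
        · exact ⟨1, by omega, by omega⟩
        · exact ⟨0, by omega, by omega⟩
      obtain ⟨v', hv'⟩ := hl j' hj'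
      obtain ⟨i', rfl⟩ := hb.2 v'
      have := hn (i' - i).val
      have hval : ∀ y : Fin 8, y.val • (1 : Fin 8) = y := by decide
      rw [hval, add_sub_cancel] at this
      omega
    choose! g hg1 hg2 using hex
    have hc : (Finset.range (z + 1)).card ≤ (Finset.univ.filter (fun v => l v = 0)).card := by
      apply Finset.card_le_card_of_injOn (fun j => f (g j + 1))
      · intro j hj
        simp at hj
        simp [hg2 j (by omega)]
      · intro a ha b hb' hab
        simp at ha hb'
        have h1 := hf hab
        have h2 : g a = g b := add_right_cancel h1
        have h3 := hg1 a (by omega)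
        have h4 := hg1 b (by omega)
        rw [h2] at h3
        omega
    rw [Finset.card_range] at hc
    omega

/-- A vertex of degree at most two kills the arrow. -/
theorem low_degree {V : Type} [Fintype V] (hV : Fintype.card V = 8) (F : SimpleGraph V)
    [DecidableRel F.Adj] (v : V) (hd : F.degree v ≤ 2) :
    ¬ Arrows F (pathGraph 3) (cycleGraph 8) := by
  classical
  have h1 : ∃ s : Finset V, F.neighborFinset v ⊆ s ∧ s ⊆ Finset.univ.erase v ∧ s.card = 2 := by
    apply Finset.exists_subsuperset_card_eq
    · intro w hw
      rw [mem_neighborFinset] at hw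
      simp [hw.ne']
    · simpa using hd
    · rw [Finset.card_erase_of_mem (Finset.mem_univ _), Finset.card_univ, hV]; omega
  obtain ⟨s, hs1, hs2, hs3⟩ := h1
  obtain ⟨a, b, hab, rfl⟩ := Finset.card_eq_two.1 hs3
  have hav : a ≠ v := by
    have := hs2 (show a ∈ ({a, b} : Finset V) by simp)
    simpa using this
  have hbv : b ≠ v := by
    have := hs2 (show b ∈ ({a, b} : Finset V) by simp)
    simpa using this
  have hN : ∀ w, F.Adj v w → w = a ∨ w = b := by
    intro w hw
    have := hs1 ((mem_neighborFinset _ _ _).2 hw)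
    simpa using this
  apply tough hV F (fun w => if w = v then 1 else if w = a then 0 else 2) 1 le_rfl
  · have : (Finset.univ.filter (fun w => (if w = v then 1 else if w = a then 0 else 2) = 0))
        ⊆ ({a} : Finset V) := by
      intro w hw
      simp only [Finset.mem_filter, Finset.mem_univ, true_and] at hw
      split_ifs at hw with h1 h2
      simp [h2]
    simpa using Finset.card_le_card this
  · intro j hj
    have : j = 0 ∨ j = 1 := by omega
    rcases this with rfl | rfl
    · exact ⟨v, by simp⟩
    · exact ⟨b, by simp [hbv, hab.symm]⟩
  · have hv : ∀ w, F.Adj v w → w ≠ a → w = b := fun w h1 h2 => (hN w h1).resolve_left h2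
    intro x y w hxy hx hy hne hxw hw hne'
    by_cases hxv : x = v
    · subst hxv
      have e1 := hv y hxy (by rintro rfl; simp [hav] at hy)
      have e2 := hv w hxw (by rintro rfl; simp [hav] at hw)
      rw [e1, e2]
    · have hxa : x ≠ a := by rintro rfl; simp [hav] at hx
      have e1 : y = v := by
        by_contra h
        have : y ≠ a := by rintro rfl; simp [h] at hy
        simp [hxv, hxa, h, this] at hne
      have e2 : w = v := by
        by_contra h
        have : w ≠ a := by rintro rfl; simp [h] at hw
        simp [hxv, hxa, h, this] at hne'
      rw [e1, e2]

/-- Exchanging two vertices in a numbering that maximizes the weighted edge sum. -/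
theorem swap_ineq {ι : Type} [Fintype ι] [DecidableEq ι] (x : ι → ℤ) (a : ι → ι → ℤ)
    (hs : ∀ u v, a u v = a v u) (h0 : ∀ u, a u u = 0) (i j : ι) (hij : i ≠ j) (hx : x j < x i)
    (hmax : ∑ u, ∑ v, x u * x v * a (Equiv.swap i j u) (Equiv.swap i j v)
      ≤ ∑ u, ∑ v, x u * x v * a u v) :
    ∑ k, (if k = i ∨ k = j then 0 else x k * a j k)
      ≤ ∑ k, (if k = i ∨ k = j then 0 else x k * a i k) := by
  have split : ∀ f : ι → ℤ, ∑ k, f k = f i + f j + ∑ k, (if k = i ∨ k = j then 0 else f k) := by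
    intro f
    have : ∀ k, f k = (if k = i then f i else 0) + (if k = j then f j else 0)
        + (if k = i ∨ k = j then 0 else f k) := by
      intro k
      by_cases h1 : k = i
      · subst h1; simp [hij]
      · by_cases h2 : k = j
        · subst h2; simp [h1]
        · simp [h1, h2]
    rw [Finset.sum_congr rfl (fun k _ => this k)]
    simp [Finset.sum_add_distrib]
  have quad : ∀ y : ι → ℤ, (∀ k, k ≠ i → k ≠ j → y k = x k) →
      ∑ u, ∑ v, y u * y v * a u v = 2 * y i * y j * a i j
        + 2 * y i * ∑ k, (if k = i ∨ k = j then 0 else x k * a i k)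
        + 2 * y j * ∑ k, (if k = i ∨ k = j then 0 else x k * a j k)
        + ∑ u, (if u = i ∨ u = j then 0 else
            ∑ v, (if v = i ∨ v = j then 0 else x u * x v * a u v)) := by
    intro y hy
    have inner : ∀ u, ∑ v, y u * y v * a u v = y u * y i * a u i + y u * y j * a u j
        + y u * ∑ k, (if k = i ∨ k = j then 0 else x k * a u k) := by
      intro u
      rw [split, Finset.mul_sum]
      congr 1
      apply Finset.sum_congr rfl
      intro k _
      by_cases h : k = i ∨ k = j
      · simp [h]
      · rw [if_neg h, if_neg h, hy k (fun e => h (Or.inl e)) (fun e => h (Or.inr e))]; ring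
    rw [split, inner i, inner j, h0 i, h0 j, hs j i]
    have rest : ∑ u, (if u = i ∨ u = j then 0 else ∑ v, y u * y v * a u v)
        = y i * ∑ k, (if k = i ∨ k = j then 0 else x k * a i k)
        + y j * ∑ k, (if k = i ∨ k = j then 0 else x k * a j k)
        + ∑ u, (if u = i ∨ u = j then 0 else
            ∑ v, (if v = i ∨ v = j then 0 else x u * x v * a u v)) := by
      rw [Finset.mul_sum, Finset.mul_sum, ← Finset.sum_add_distrib, ← Finset.sum_add_distrib]
      apply Finset.sum_congr rfl
      intro u _
      by_cases h : u = i ∨ u = j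
      · simp [h]
      · rw [if_neg h, if_neg h, if_neg h, if_neg h, inner u,
          hy u (fun e => h (Or.inl e)) (fun e => h (Or.inr e)), hs u i, hs u j, Finset.mul_sum]
        have : ∑ k, x u * (if k = i ∨ k = j then 0 else x k * a u k)
            = ∑ v, (if v = i ∨ v = j then 0 else x u * x v * a u v) := by
          apply Finset.sum_congr rfl
          intro k _
          split_ifs
          · simp
          · ring
        rw [this]; ring
    rw [rest]; ring
  have e1 : ∑ u, ∑ v, x u * x v * a (Equiv.swap i j u) (Equiv.swap i j v)
      = ∑ u, ∑ v, x (Equiv.swap i j u) * x (Equiv.swap i j v) * a u v := by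
    rw [← Equiv.sum_comp (Equiv.swap i j)]
    apply Finset.sum_congr rfl
    intro u _
    rw [← Equiv.sum_comp (Equiv.swap i j)]
    simp
  rw [e1, quad x (fun _ _ _ => rfl), quad (fun k => x (Equiv.swap i j k))
    (fun k h1 h2 => by rw [Equiv.swap_apply_of_ne_of_ne h1 h2])] at hmax
  simp only [Equiv.swap_apply_left, Equiv.swap_apply_right] at hmax
  nlinarith

/-- The normalization used in the search. -/
structure Norm (F : SimpleGraph (Fin 8)) [DecidableRel F.Adj] : Prop where
  deg : ∀ v, 3 ≤ ∑ w, (if F.Adj v w then 1 else 0)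
  tot : ∑ v, ∑ w, (if F.Adj v w then 1 else 0) ≤ 28
  sym : ∀ i j : Fin 8, j < i →
    ∑ k : Fin 8, (if k = i ∨ k = j then 0 else 2 ^ k.val * (if F.Adj j k then 1 else 0))
    ≤ ∑ k : Fin 8, (if k = i ∨ k = j then 0 else 2 ^ k.val * (if F.Adj i k then 1 else 0))

def lab (n : ℕ) (v : Fin 8) : ℕ := (n >>> (3 * v.val)) % 8

def isBad (n E0 : ℕ) (u v : Fin 8) : Bool :=
  (lab n u != 0) && (lab n v != 0) && (lab n u != lab n v) && !(bt E0 u v)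

def labZ (n : ℕ) : ℕ := sum8 (fun v => if lab n v = 0 then 1 else 0)

def labOK (n : ℕ) : Bool :=
  Nat.ble 1 (labZ n) && (List.range (labZ n + 1)).all (fun j => any8 (fun v => lab n v == j + 1))

def checkB (E1 : ℕ) : Bool :=
  Nat.ble 29 (sum8 (fun u => max 3 (sum8 (fun v => if bt E1 u v then 1 else 0))))

def checkD (E0 : ℕ) (u : Fin 8) : Bool :=
  Nat.ble (sum8 (fun v => if bt E0 u v then 0 else 1)) 2

def checkY (E1 E0 : ℕ) (i j : Fin 8) : Bool :=
  decide (j < i) && Nat.ble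
    (sum8 (fun k => if k = i ∨ k = j then 0 else 2 ^ k.val * (if bt E0 i k then 0 else 1)) + 1)
    (sum8 (fun k => if k = i ∨ k = j then 0 else 2 ^ k.val * (if bt E1 j k then 1 else 0)))

def checkL (E0 n : ℕ) : Bool :=
  labOK n && all8 (fun u => Nat.ble (sum8 (fun v => if isBad n E0 u v then 1 else 0)) 1)

/-- Search trees: `E1` holds known edges, `E0` known non-edges. -/
inductive T where
  | B : T
  | D (u : Fin 8) : T
  | Y (i j : Fin 8) : T
  | L (n : ℕ) : T
  | N (u v : Fin 8) (s t : T) : T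

def check : T → ℕ → ℕ → Bool
  | .B, E1, _ => checkB E1
  | .D u, _, E0 => checkD E0 u
  | .Y i j, E1, E0 => checkY E1 E0 i j
  | .L n, _, E0 => checkL E0 n
  | .N u v s t, E1, E0 => check s (ins E1 u v) E0 && check t E1 (ins E0 u v)

def Good (F : SimpleGraph (Fin 8)) (n : ℕ) : Prop :=
  labOK n = true ∧ ∀ u v w, F.Adj u v → lab n u ≠ 0 → lab n v ≠ 0 → lab n u ≠ lab n v →
      F.Adj u w → lab n w ≠ 0 → lab n u ≠ lab n w → v = w

theorem check_sound (F : SimpleGraph (Fin 8)) [DecidableRel F.Adj] (hF : Norm F) (t : T) :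
    ∀ E1 E0 : ℕ, (∀ u v, bt E1 u v = true → F.Adj u v) →
      (∀ u v, bt E0 u v = true → ¬ F.Adj u v) → check t E1 E0 = true → ∃ n, Good F n := by
  induction t with
  | B =>
    intro E1 E0 h1 h0 hc
    exfalso
    simp only [check, checkB, Nat.ble_eq, sum8_eq] at hc
    have : ∑ u : Fin 8, max 3 (∑ v : Fin 8, if bt E1 u v = true then 1 else 0)
        ≤ ∑ u, ∑ w, (if F.Adj u w then 1 else 0) := by
      apply Finset.sum_le_sum
      intro u _
      apply max_le (hF.deg u)
      apply Finset.sum_le_sum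
      intro v _
      by_cases h : bt E1 u v = true
      · simp [h, h1 u v h]
      · simp [h]
    have := hF.tot
    omega
  | D u =>
    intro E1 E0 h1 h0 hc
    exfalso
    simp only [check, checkD, Nat.ble_eq, sum8_eq] at hc
    have : ∑ w, (if F.Adj u w then 1 else 0) ≤ ∑ v : Fin 8, if bt E0 u v = true then 0 else 1 := by
      apply Finset.sum_le_sum
      intro v _
      by_cases h : bt E0 u v = true
      · simp [h, h0 u v h]
      · rw [if_neg h]; split_ifs <;> simp
    have := hF.deg u
    omega
  | Y i j =>
    intro E1 E0 h1 h0 hc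
    exfalso
    simp only [check, checkY, Nat.ble_eq, sum8_eq, Bool.and_eq_true, decide_eq_true_eq] at hc
    obtain ⟨hij, hc⟩ := hc
    have a1 : ∑ k : Fin 8, (if k = i ∨ k = j then 0 else 2 ^ k.val * (if F.Adj i k then 1 else 0))
        ≤ ∑ k : Fin 8, (if k = i ∨ k = j then 0 else
          2 ^ k.val * (if bt E0 i k = true then 0 else 1)) := by
      apply Finset.sum_le_sum
      intro k _
      by_cases h' : k = i ∨ k = j
      · simp [h']
      rw [if_neg h', if_neg h']
      apply Nat.mul_le_mul_left
      by_cases h : bt E0 i k = true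
      · simp [h, h0 i k h]
      · rw [if_neg h]; split_ifs <;> simp
    have a2 : ∑ k : Fin 8, (if k = i ∨ k = j then 0 else
          2 ^ k.val * (if bt E1 j k = true then 1 else 0))
        ≤ ∑ k : Fin 8, (if k = i ∨ k = j then 0 else
          2 ^ k.val * (if F.Adj j k then 1 else 0)) := by
      apply Finset.sum_le_sum
      intro k _
      by_cases h' : k = i ∨ k = j
      · simp [h']
      rw [if_neg h', if_neg h']
      apply Nat.mul_le_mul_left
      by_cases h : bt E1 j k = true
      · simp [h, h1 j k h]
      · simp [h]
    have := hF.sym i j hij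
    omega
  | L n =>
    intro E1 E0 h1 h0 hc
    simp only [check, checkL, Nat.ble_eq, sum8_eq, Bool.and_eq_true, all8_iff] at hc
    refine ⟨n, hc.1, ?_⟩
    intro u v w huv hu hv hne huw hw hne'
    have hb : ∀ y, F.Adj u y → lab n y ≠ 0 → lab n u ≠ lab n y → isBad n E0 u y = true := by
      intro y h1 h2 h3
      have : bt E0 u y = false := by
        by_contra h
        exact h0 u y (by simpa using h) h1
      simp [isBad, hu, h2, h3, this]
    have hcu := hc.2 u
    rw [← Finset.card_filter] at hcu
    exact Finset.card_le_one.1 hcu v (by simp [hb v huv hv hne]) w (by simp [hb w huw hw hne'])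
  | N u v s t ihs iht =>
    intro E1 E0 h1 h0 hc
    simp only [check, Bool.and_eq_true] at hc
    by_cases h : F.Adj u v
    · apply ihs _ _ _ h0 hc.1
      intro a b hab
      rcases (bt_ins _ _ _ _ _).1 hab with h' | ⟨rfl, rfl⟩ | ⟨rfl, rfl⟩
      · exact h1 a b h'
      · exact h
      · exact h.symm
    · apply iht _ _ h1 _ hc.2
      intro a b hab
      rcases (bt_ins _ _ _ _ _).1 hab with h' | ⟨rfl, rfl⟩ | ⟨rfl, rfl⟩
      · exact h0 a b h'
      · exact h
      · exact fun h' => h h'.symm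

open T in
/-- The search tree for the lower bound. -/
def tree : T :=
(N 3 7
(N 4 7
(N 5 7
(N 6 7
(N 4 6
(N 5 6
(N 1 7
(N 2 7
(N 3 6
(N 0 6
B (N 0 7
B (N 1 6
B (N 2 6
B (N 4 5
(N 0 4
B (N 0 5
B (N 0 1
(N 0 2
(N 0 3
(N 1 3
B (N 1 4
B (N 1 5
B (L 4793353)))) (D 0)) (D 0)) (D 0)))) (N 3 4
(Y 5 3) (N 3 5
(Y 4 3) (N 2 5
(N 0 5
B (N 1 5
B (N 0 2
(N 1 2
B (N 0 1
(N 1 3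
(N 0 3
B (N 0 4
(N 1 4
B (L 631817)) (D 0))) (L 885329)) (L 7176401))) (N 0 1
(N 0 3
(N 0 4
(N 1 2
(N 1 3
B (N 1 4
B (L 365073))) (L 1147089)) (D 0)) (D 0)) (D 0))))) (N 1 5
(Y 2 1) (N 0 5
(N 1 3
(Y 5 3) (N 0 1
(N 0 3
(N 0 2
B (N 0 4
B (L 303761))) (L 595017)) (L 885329))) (D 5))))))))))) (N 1 6
(Y 3 1) (N 2 6
(Y 3 2) (N 3 5
(N 4 5
(Y 6 5) (N 2 5
(N 0 5
B (N 0 6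
B (N 0 7
B (N 1 5
B (N 0 2
(N 1 2
B (N 0 1
(N 0 3
(N 0 4
B (N 1 3
B (L 819793))) (L 853129)) (L 819793))) (N 0 1
(N 0 3
(N 0 4
(N 1 2
(N 1 3
B (L 853129)) (L 1147089)) (D 0)) (D 0)) (D 0))))))) (N 1 5
(Y 2 1) (N 1 4
(N 2 4
(N 0 4
B (N 0 5
B (N 0 6
B (L 594505)))) (Y 2 1)) (N 1 2
(N 1 3
(N 2 4
(N 2 3
B (N 3 4
B (L 865352))) (L 929928)) (L 894088)) (L 929928)))))) (N 1 5
(Y 3 1) (N 2 5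
(Y 3 2) (N 1 2
(N 1 3
(N 1 4
(Y 5 4) (N 2 3
(N 2 4
(Y 5 4) (N 3 4
(Y 5 4) (N 4 5
(N 0 1
(N 0 2
B (Y 2 1)) (N 0 2
(N 0 3
B (Y 3 2)) (L 300177))) (L 930880)))) (L 1147976))) (L 1147976)) (L 1147528)))))))) (Y 2 1)) (N 0 7
(Y 1 0) (N 0 6
(N 1 6
(N 2 6
(N 2 7
B (N 3 6
B (N 2 5
(N 0 5
B (N 1 5
B (N 3 5
B (N 3 4
(Y 5 4) (N 4 5
B (N 0 3
(N 1 3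
(N 2 3
B (N 0 1
(N 0 2
B (N 0 4
B (L 4792961))) (N 0 2
(N 0 4
B (L 6434833)) (L 107153)))) (L 365577)) (L 365577))))))) (N 0 5
(Y 2 0) (N 1 5
(Y 2 1) (N 0 1
(N 0 2
(N 0 3
B (N 0 4
B (N 1 2
(N 1 3
B (N 1 4
B (L 6403601))) (L 8487049)))) (L 8487049)) (L 8486993))))))) (N 2 7
(N 3 6
B (N 3 5
(N 0 5
B (N 1 5
B (N 2 5
B (N 4 5
B (N 0 4
(N 1 4
B (Y 1 0)) (N 0 1
(N 0 2
(N 0 3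
B (N 1 2
(N 1 3
B (N 1 4
B (L 6434833))) (L 4300937))) (L 4300945)) (L 6434833))))))) (N 2 5
(Y 3 2) (N 2 4
(Y 5 4) (N 3 4
(Y 5 4) (N 4 5
(N 0 4
B (N 0 5
B (N 0 2
(N 0 3
(N 0 1
B (N 1 2
(N 1 3
(N 1 4
B (N 1 5
B (L 107081))) (Y 3 2)) (L 4792401))) (L 7189505)) (L 7188609)))) (L 930880))))))) (Y 2 0))) (Y 1 0)) (N 3 4
(N 3 5
(N 3 6
(N 4 5
B (Y 4 3)) (N 4 5
(Y 6 4) (N 2 6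
(N 2 7
(Y 3 2) (N 2 4
(N 2 5
(N 0 2
B (N 0 3
B (N 0 1
(N 0 4
B (D 0)) (D 0)))) (Y 5 4)) (N 0 1
(N 0 2
(N 0 3
(N 0 4
B (N 0 5
B (N 2 5
(N 1 2
B (N 1 3
B (N 1 4
B (L 8401033)))) (L 6434945)))) (N 0 4
(N 0 5
B (N 1 2
(N 2 3
B (N 2 5
B (L 4793409))) (N 2 5
(N 1 3
B (N 1 4
B (N 1 5
B (D 1)))) (L 6393993)))) (N 0 5
(N 1 2
(N 2 3
B (N 2 5
B (L 4793409))) (N 1 4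
(N 1 3
B (N 1 5
B (N 1 6
B (D 1)))) (L 8401033))) (D 0)))) (N 0 3
(N 0 4
(N 0 5
B (N 1 3
B (N 1 4
B (N 1 2
(N 1 5
B (L 6369417)) (L 8392913))))) (N 0 5
(N 1 2
(N 1 3
B (N 1 4
B (L 8401033))) (L 8397009)) (D 0))) (N 0 4
(N 0 5
(N 1 3
B (L 6817425)) (D 0)) (D 0)))) (N 0 2
(N 0 3
(N 0 4
(N 0 5
B (N 1 3
B (N 1 4
B (N 1 2
(N 1 5
B (D 1)) (D 1))))) (N 0 5
(N 1 2
(N 1 3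
B (N 1 4
B (L 7091729))) (L 8397009)) (D 0))) (N 0 4
(N 0 5
(N 1 3
B (L 9438737)) (D 0)) (D 0))) (N 0 3
(N 0 4
(N 0 5
B (D 0)) (D 0)) (D 0)))))) (N 2 3
(Y 6 3) (N 0 3
(N 1 3
(Y 6 3) (N 1 6
(N 2 7
(N 0 4
B (N 0 5
B (N 0 1
(N 0 2
(N 1 4
B (N 1 5
B (L 4793353))) (D 0)) (D 0)))) (Y 2 1)) (Y 6 3))) (N 2 7
(N 1 3
(N 1 6
(N 0 4
B (N 0 1
(N 0 2
(N 0 5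
B (D 0)) (D 0)) (D 0))) (Y 6 3)) (N 0 1
(N 0 2
(N 1 2
(N 1 6
(N 1 4
B (N 1 5
B (N 0 4
(N 0 5
B (L 4793353)) (L 4793353)))) (L 7341585)) (L 4720265)) (L 4720273)) (L 9438737))) (L 7341697))))))) (Y 5 4)) (N 0 1
(N 0 2
(N 0 3
(N 0 4
(N 0 5
(N 4 5
B (N 1 4
(N 1 5
B (N 1 6
B (Y 1 0))) (N 1 6
(N 1 5
B (N 2 4
B (N 1 2
(N 1 3
B (L 4273288)) (L 4273288)))) (Y 1 0)))) (N 1 2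
(N 2 4
(N 2 6
B (N 2 7
B (N 1 6
(Y 2 1) (N 1 3
(N 1 4
B (N 1 5
(N 2 3
B (N 2 5
B (Y 2 0))) (Y 1 0))) (N 1 5
(N 1 4
B (N 2 5
B (Y 2 1))) (Y 1 0)))))) (N 2 6
(N 2 7
B (N 3 6
(Y 7 6) (N 1 4
(N 1 3
B (N 1 5
B (N 1 6
B (Y 1 0)))) (N 1 6
(N 1 3
B (N 1 5
B (N 2 3
B (L 6309512)))) (L 4727369))))) (N 1 6
(N 1 4
B (N 2 7
(N 1 3
B (N 1 5
B (N 2 3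
B (N 2 5
B (L 4793416))))) (Y 2 1))) (N 1 4
(N 1 3
(N 1 5
B (N 2 3
B (N 2 7
B (N 2 5
(N 3 5
B (N 3 6
B (L 7189568))) (D 2))))) (N 1 5
(N 2 5
B (N 2 3
(N 2 7
B (Y 2 0)) (L 4785225))) (Y 1 0))) (N 1 5
(N 2 5
(N 2 7
B (N 3 6
(N 1 3
B (N 2 3
B (L 7091848))) (L 4727369))) (L 4792393)) (Y 1 0)))))) (N 1 5
(N 4 5
(N 1 4
B (N 1 6
B (N 1 3
(N 2 3
B (N 2 4
B (N 2 5
B (N 2 6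
B (D 2))))) (D 1)))) (N 1 4
(N 1 6
B (N 2 5
(N 1 3
B (N 2 4
B (N 2 6
B (N 2 3
(N 2 7
B (Y 2 1)) (L 7091848))))) (N 3 5
(N 1 3
B (N 2 3
B (N 2 4
B (L 50824)))) (Y 5 4)))) (N 1 3
(N 2 4
(N 1 6
B (N 3 5
B (N 2 5
(N 2 3
B (N 2 6
B (N 2 7
B (L 7091848)))) (Y 5 4)))) (N 3 6
(Y 4 3) (N 1 6
(N 2 3
B (N 2 5
B (N 2 6
B (D 2)))) (N 2 3
(N 2 6
(N 2 5
B (N 2 7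
B (L 7188616))) (L 1061512)) (L 542344))))) (N 1 6
(N 2 4
(N 2 5
B (N 2 3
(N 2 6
B (N 2 7
B (Y 2 0))) (L 50824))) (L 4273288)) (D 1))))) (N 1 6
(N 1 3
(N 1 4
B (N 3 6
B (N 3 5
(N 2 3
B (N 2 4
B (N 2 5
B (L 6403720)))) (L 4792841)))) (N 1 4
(N 2 4
B (N 2 6
B (N 2 7
B (Y 2 1)))) (D 1))) (Y 1 0))))) (N 0 5
(N 3 5
(N 3 6
B (N 4 5
(Y 6 5) (N 1 5
(N 1 3
B (N 1 6
B (N 1 4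
(N 1 2
B (N 2 3
B (L 4728456))) (Y 1 0)))) (N 1 6
(N 1 3
B (N 1 4
(N 1 2
B (N 2 3
B (N 2 4
B (L 83592)))) (L 2142737))) (Y 1 0))))) (N 2 4
(N 2 5
(N 2 6
B (N 2 7
B (N 1 6
(Y 2 1) (N 1 2
(N 1 4
B (N 1 3
(N 1 5
B (Y 1 0)) (Y 1 0))) (L 9175177))))) (Y 5 4)) (N 1 4
(N 1 5
(N 1 6
B (N 4 5
B (N 1 3
(N 1 2
B (N 2 3
B (N 2 5
B (L 45705)))) (N 2 3
(N 3 6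
B (L 832521)) (L 46153))))) (N 1 6
(N 2 5
(N 1 2
B (N 1 3
B (N 2 3
(N 2 6
B (N 2 7
B (Y 2 0))) (L 4269704)))) (Y 5 4)) (Y 1 0))) (N 4 5
(N 1 3
(N 3 6
B (N 1 5
(N 1 2
B (N 1 6
B (Y 1 0))) (L 4792841))) (N 1 2
(N 1 6
(N 1 5
B (N 2 3
(N 2 5
B (L 144456)) (L 4269704))) (Y 1 0)) (L 2110033))) (D 4))))) (N 1 2
(N 1 3
(N 1 6
(N 3 6
B (N 2 3
(N 1 4
B (N 1 5
B (N 2 4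
B (N 2 5
B (N 2 6
B (L 4792393)))))) (N 3 5
(N 1 4
B (N 1 5
B (N 2 5
B (N 2 6
B (L 598601))))) (L 4792961)))) (N 1 4
(N 1 5
(N 3 5
B (N 3 6
B (N 2 3
(N 2 4
B (N 2 5
B (N 2 6
B (N 2 7
B (Y 2 1))))) (L 4792961)))) (N 3 5
(N 3 6
B (N 4 5
B (N 2 3
(N 2 4
B (N 2 5
B (L 598601))) (N 2 4
(N 2 5
B (N 2 6
B (L 865345))) (L 602753))))) (N 2 4
(Y 5 4) (N 2 5
(N 2 6
(N 2 3
B (N 2 7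
B (L 4268617))) (L 598601)) (Y 5 4))))) (N 1 5
(N 3 5
(N 2 3
B (N 2 5
B (N 2 6
B (N 2 4
(N 2 7
B (Y 2 1)) (L 4793409))))) (N 3 6
(N 2 3
B (N 2 5
B (N 2 4
(Y 5 4) (L 144449)))) (L 4792841))) (L 7188497)))) (N 1 4
(N 3 6
(N 2 7
(N 1 6
B (N 1 5
(N 2 3
B (N 2 4
B (N 2 5
B (N 2 6
B (L 4793409))))) (L 4793353))) (N 1 6
(Y 7 6) (N 1 5
(N 2 6
(Y 7 6) (N 2 4
(N 2 3
B (N 2 5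
B (Y 2 1))) (Y 2 1))) (L 4793353)))) (N 3 5
(N 4 5
(Y 6 5) (N 1 5
(N 1 6
B (N 2 3
(N 2 4
B (N 2 5
B (N 2 6
B (L 893505)))) (N 2 4
(N 2 5
B (N 2 6
B (L 865345))) (L 602753)))) (N 1 6
(N 2 3
(N 2 4
B (N 2 5
B (L 107081))) (N 2 4
(N 2 5
B (L 332873)) (L 602753))) (L 4793353)))) (L 4792849))) (N 1 5
(N 1 6
(N 4 5
(N 2 4
B (N 2 5
B (N 2 3
(N 2 6
B (N 2 7
B (Y 2 1))) (L 4269129)))) (L 4273161)) (L 4793353)) (L 4793353)))) (N 1 4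
(N 1 5
(N 1 6
(N 4 5
B (N 2 4
(N 1 3
B (N 2 5
B (N 2 6
B (N 2 7
B (Y 2 1))))) (N 2 7
(N 1 3
B (N 2 5
B (N 2 3
(N 2 6
B (L 929921)) (L 50824)))) (Y 2 1)))) (N 2 7
(N 3 6
(N 1 3
B (N 3 5
B (N 4 5
B (N 2 3
(N 2 4
B (Y 4 3)) (N 2 4
(N 2 5
B (Y 5 4)) (L 50824)))))) (N 2 3
(N 2 6
(Y 3 2) (N 1 3
(N 2 4
B (N 2 5
B (L 4792401))) (L 2884177))) (L 4727433))) (N 2 6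
(N 3 6
(Y 7 6) (N 1 3
(N 2 3
(N 2 4
B (L 4727369)) (L 4727433)) (L 7078481))) (L 9175177)))) (N 1 6
(N 2 6
(N 3 6
(Y 7 6) (N 2 7
(Y 3 2) (N 2 5
(N 2 4
B (N 1 3
(N 2 3
B (L 6304393)) (L 4727377))) (L 8487049)))) (N 2 7
(N 2 3
(N 1 3
B (N 2 4
B (N 2 5
(N 3 5
B (L 598609)) (L 4792401)))) (N 3 5
(N 1 3
B (N 2 5
(N 2 4
B (N 3 6
B (L 1061953))) (L 7177864))) (L 4268681))) (Y 2 1))) (L 4792457))) (N 1 5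
(N 1 6
(N 1 3
(N 3 5
B (N 2 3
(N 2 5
B (N 2 4
(Y 5 4) (N 2 6
B (L 4792401)))) (L 4268681))) (N 2 4
(N 2 7
(N 2 5
B (N 2 6
B (N 3 5
(N 2 3
B (N 3 6
B (L 300680))) (Y 5 4)))) (L 6304337)) (L 2110033))) (L 4792457)) (L 4792457)))))) (N 0 4
(N 0 5
(N 1 6
(N 4 5
B (N 2 6
(N 1 4
B (N 1 5
B (N 2 4
B (N 1 2
(N 1 3
B (L 4273288)) (L 4273288))))) (N 2 7
(N 1 4
B (N 1 5
B (N 2 4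
B (N 1 2
(N 1 3
B (L 4273288)) (L 4273288))))) (Y 2 1)))) (N 1 4
(N 1 5
(N 1 2
B (N 1 3
B (Y 1 0))) (Y 1 0)) (Y 1 0))) (N 3 6
(N 1 6
(N 2 6
(Y 7 6) (N 2 7
(N 1 4
B (N 2 4
B (N 4 5
B (N 1 3
(Y 4 3) (N 1 2
(N 1 5
B (L 4273288)) (L 4273288)))))) (Y 2 1))) (N 1 3
(N 1 5
(N 2 7
(N 1 4
B (N 3 5
B (N 4 5
B (N 2 3
(Y 4 3) (N 2 4
(N 1 2
B (N 2 5
B (Y 5 4))) (Y 4 3)))))) (N 2 6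
(Y 7 6) (N 1 2
(N 1 4
B (N 2 5
(N 2 3
B (N 2 4
B (Y 2 1))) (Y 2 1))) (L 9175177)))) (N 1 2
(N 1 4
(N 2 3
B (N 2 4
B (N 2 6
B (N 2 5
(N 2 7
B (L 4793409)) (L 4793409))))) (Y 1 0)) (L 4785289))) (N 1 2
(N 1 4
(N 1 5
(N 2 4
B (N 2 5
B (N 2 6
B (N 2 3
(N 2 7
B (Y 2 0)) (L 4793409))))) (L 7177745)) (L 4793353)) (L 4785289)))) (N 3 5
(N 4 5
(Y 6 5) (N 1 3
(N 2 3
(N 1 4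
(N 1 5
B (N 1 6
B (N 1 2
(N 2 4
B (N 2 5
B (N 2 6
B (L 865345)))) (L 4785289)))) (N 1 5
(N 1 6
B (N 1 2
(N 2 4
B (N 2 5
B (N 2 6
B (L 865345)))) (N 2 5
(N 2 4
B (N 2 6
B (L 1061512))) (L 332881)))) (N 1 6
(N 1 2
(N 2 4
B (N 2 5
B (L 107081))) (N 2 4
(N 2 5
B (L 2199633)) (L 4273288))) (Y 1 0)))) (N 2 4
(N 1 5
(N 1 4
B (N 1 6
B (N 1 2
(N 2 5
B (N 2 6
B (L 889921))) (L 2364497)))) (N 2 5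
(N 2 6
B (N 1 6
(N 1 2
B (N 1 4
B (L 595025))) (L 791625))) (L 332873))) (L 595585))) (N 1 4
(N 1 6
(N 1 5
B (N 1 2
(N 2 3
(N 2 4
B (N 2 5
B (L 332873))) (D 3)) (L 4785289))) (L 7341585)) (L 7091209)))) (L 7189505)))) (N 0 5
(N 3 6
(N 1 6
(N 2 6
(Y 7 6) (N 2 7
(N 1 5
B (N 2 5
B (N 3 5
B (N 1 3
(N 1 2
B (N 1 4
B (N 2 3
B (L 140936)))) (L 6403081))))) (Y 2 1))) (N 1 5
(N 2 7
(N 2 5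
B (N 2 6
B (N 3 5
B (N 2 3
(N 1 2
B (N 1 3
B (L 4727945))) (L 898113))))) (N 2 6
(Y 7 6) (N 1 2
(N 2 5
(N 1 3
B (N 1 4
B (L 7091729))) (Y 2 0)) (L 9175177)))) (Y 1 0))) (N 1 3
(N 2 3
(N 3 5
(N 4 5
(Y 6 5) (N 1 4
(N 1 5
B (N 1 6
B (Y 1 0))) (N 1 5
(N 1 2
B (N 1 6
B (L 1061897))) (L 4273161)))) (L 7189505)) (L 4728449)) (L 4728337))) (D 0)))) (N 0 3
(N 0 4
(N 0 5
(N 1 6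
(N 4 5
B (N 2 6
(N 1 4
B (N 1 5
B (N 2 4
B (N 1 2
(N 1 3
B (L 4273288)) (L 4273288))))) (N 2 7
(N 1 4
B (N 1 5
B (N 2 4
B (N 1 2
(N 1 3
B (L 4273288)) (L 4273288))))) (Y 2 1)))) (N 1 3
(N 1 4
(N 1 5
B (Y 1 0)) (Y 1 0)) (Y 1 0))) (N 1 2
(N 1 3
(N 3 6
(N 1 4
B (N 1 6
B (N 1 5
(N 2 3
B (N 2 4
B (N 2 5
B (N 2 6
B (D 2))))) (Y 1 0)))) (N 3 5
(N 4 5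
(Y 6 5) (N 1 4
(N 1 5
B (N 1 6
B (N 2 3
B (N 2 4
B (L 594569))))) (N 1 5
(N 1 6
B (N 2 3
B (L 4727433))) (N 1 6
(N 2 3
B (N 2 4
B (L 78473))) (Y 1 0))))) (N 2 3
(N 1 4
(N 1 5
B (N 1 6
B (N 2 4
B (N 2 5
(N 2 6
B (N 2 7
B (L 4792904))) (Y 5 4))))) (N 1 5
(N 1 6
B (L 4792841)) (L 4792841))) (L 4792961)))) (N 1 5
(N 1 4
(N 1 6
B (N 4 5
B (N 2 5
(N 2 4
B (N 2 6
B (N 2 3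
(N 2 7
B (Y 2 1)) (L 890497)))) (N 3 5
(N 2 3
B (N 2 4
B (L 144001))) (Y 5 4))))) (N 1 6
(N 4 5
B (N 2 5
(N 2 4
B (N 2 6
B (N 2 3
(N 2 7
B (Y 2 1)) (L 890497)))) (N 2 7
(N 2 4
B (N 2 3
(N 2 6
B (L 7188609)) (L 50824))) (Y 2 1)))) (N 2 6
(N 2 7
(N 2 4
B (N 2 5
B (N 3 5
(N 2 3
B (N 3 6
B (Y 3 2))) (Y 3 2)))) (N 3 6
(Y 7 6) (N 2 3
(N 2 4
(N 2 5
B (N 3 5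
B (Y 5 4))) (L 4727369)) (L 4728456)))) (N 2 7
(N 3 6
(N 3 5
B (N 4 5
B (N 2 3
(N 2 4
B (Y 4 3)) (L 332433)))) (L 4981897)) (L 9175177))))) (N 1 6
(N 2 4
(N 1 4
B (N 3 5
(N 3 6
B (N 4 5
B (N 2 5
(N 2 3
B (N 2 6
B (N 2 7
B (Y 2 1)))) (L 4300937)))) (Y 5 4))) (N 4 5
(N 1 4
B (N 2 3
(N 3 5
B (N 2 5
(N 2 6
B (N 2 7
B (Y 2 1))) (Y 5 4))) (N 2 5
(N 2 6
B (N 2 7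
B (D 2))) (L 116360)))) (L 4265097))) (Y 1 0)))) (N 1 5
(N 1 6
(N 2 6
(N 1 4
B (N 3 6
(Y 7 6) (N 2 3
(N 1 3
B (N 2 7
(Y 3 2) (N 2 4
(N 2 5
B (Y 2 1)) (L 6309512)))) (L 4727433)))) (N 2 5
(N 1 4
B (N 2 4
(N 1 3
B (N 2 3
(N 2 7
B (Y 2 1)) (L 7079561))) (L 7090313))) (L 4784337))) (N 1 3
(N 1 4
(N 2 6
(N 2 3
B (N 2 4
B (N 2 5
B (D 2)))) (L 7340241)) (L 4792457)) (L 4785289))) (N 1 3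
(N 1 4
(N 1 6
(N 2 3
B (N 2 4
B (N 2 5
(N 2 6
B (D 2)) (D 2)))) (L 7176401)) (L 4792457)) (L 4785289))))) (N 0 5
(N 1 5
(N 3 5
(N 3 6
B (N 4 5
(Y 6 5) (N 1 3
(N 1 2
B (N 1 4
B (N 1 6
B (L 7090385)))) (N 2 3
(N 1 6
B (N 1 2
(N 1 4
B (Y 1 0)) (L 4727945))) (L 4727441))))) (N 2 5
(N 2 3
(N 3 6
B (N 2 7
(Y 3 2) (N 4 5
(Y 6 5) (N 2 4
(N 2 6
B (N 1 2
(N 1 3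
B (N 1 4
B (L 308233))) (L 8913105))) (L 602753))))) (N 3 6
(N 1 3
B (N 1 6
B (N 1 2
(N 1 4
B (Y 1 0)) (L 4727945)))) (L 4792961))) (N 2 4
(Y 5 4) (N 2 3
(N 2 6
(N 2 7
(N 1 2
B (N 1 3
B (N 1 4
(N 1 6
B (L 4727945)) (L 50824)))) (L 7188609)) (L 7188609)) (L 50817))))) (N 1 6
(N 2 6
(N 3 6
(Y 7 6) (N 2 7
(Y 3 2) (N 1 3
(N 3 5
B (N 1 4
(N 1 2
B (N 2 3
B (L 4792961))) (L 4792841))) (N 2 3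
(N 3 5
B (N 1 4
(N 2 4
(Y 5 4) (N 1 2
(N 2 5
B (Y 2 1)) (L 6403208))) (L 7189512))) (L 4727441))))) (N 2 7
(N 2 3
(N 3 5
B (N 3 6
B (N 1 4
(N 1 3
B (N 1 2
(Y 3 2) (N 2 4
(Y 3 2) (L 1061505)))) (L 4792841)))) (N 2 4
(N 3 6
(N 1 3
B (N 1 2
(N 1 4
B (N 2 5
B (N 3 5
B (Y 5 4)))) (L 7079561))) (L 1058433)) (L 7091841))) (Y 2 1))) (Y 1 0))) (D 0))) (N 0 4
(N 0 5
(N 1 6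
(N 2 6
(N 3 6
(Y 7 6) (N 2 3
(N 2 7
(Y 3 2) (N 1 3
(N 1 4
B (N 1 5
B (N 2 4
(N 1 2
B (N 2 5
B (L 8421585))) (L 7091329)))) (L 6817425))) (L 4728449))) (N 2 7
(N 4 5
B (N 2 4
(N 1 4
B (N 1 5
B (N 2 5
B (N 1 2
(N 1 3
B (N 2 3
B (L 144456))) (L 7176329))))) (N 2 3
(N 2 5
(N 1 2
B (N 1 4
B (L 7090313))) (L 890497)) (L 7091841)))) (Y 2 1))) (N 1 4
(N 1 5
(N 4 5
B (N 1 2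
(N 1 3
B (N 2 4
B (N 2 5
B (N 2 3
(N 2 6
B (L 890497)) (L 50817))))) (N 1 3
(N 2 4
B (N 2 5
B (N 2 3
(N 2 6
B (D 2)) (D 2)))) (L 7079633)))) (Y 1 0)) (Y 1 0))) (D 0)) (D 0)))) (N 0 2
(N 0 3
(N 0 4
(N 0 5
(N 1 6
(N 4 5
B (N 2 6
(N 1 4
B (N 1 5
B (N 1 2
(N 1 3
(N 2 3
B (N 2 4
B (N 2 5
B (L 144008)))) (D 1)) (D 1)))) (N 2 7
(N 1 4
B (N 1 5
B (N 1 2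
(N 1 3
(N 2 3
B (N 2 4
B (N 2 5
B (L 307848)))) (D 1)) (D 1)))) (Y 2 1)))) (N 1 2
(N 1 3
(N 1 4
(N 1 5
B (Y 1 0)) (Y 1 0)) (Y 1 0)) (Y 1 0))) (N 1 5
(N 1 6
(N 2 6
(N 3 6
(Y 7 6) (N 2 7
(Y 3 2) (N 2 5
(N 1 2
B (N 1 4
B (N 1 3
(N 2 3
B (N 2 4
B (Y 2 1))) (D 1)))) (Y 2 1)))) (N 2 7
(N 4 5
B (N 1 3
(N 1 4
B (N 3 5
B (N 3 6
B (N 1 2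
(N 2 3
B (L 889921)) (L 594513))))) (N 1 4
(N 1 2
B (N 2 3
(N 2 4
B (N 2 5
B (L 4792401))) (L 7079505))) (L 6395409)))) (Y 2 1))) (N 1 2
(N 1 3
(N 1 4
(N 3 5
B (N 2 4
(Y 5 4) (N 2 5
(N 2 3
B (N 2 6
B (N 2 7
B (Y 2 1)))) (Y 5 4)))) (L 7188497)) (L 7177745)) (L 7176401))) (N 1 2
(N 1 3
(N 1 4
(N 3 5
(N 1 6
B (N 3 6
B (N 4 5
B (N 2 5
(N 2 3
B (N 2 4
B (N 2 6
B (N 2 7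
B (L 9175121))))) (N 2 6
(N 2 3
B (N 2 4
B (N 2 7
B (L 8486993)))) (L 594505)))))) (N 2 4
(Y 5 4) (N 2 5
(N 1 6
(N 2 3
B (N 2 6
B (N 2 7
B (Y 2 1)))) (N 3 6
(N 2 3
B (N 2 6
B (N 2 7
B (L 9175121)))) (L 1147409))) (Y 5 4)))) (L 7188497)) (L 7177745)) (L 7176401)))) (N 0 5
(N 1 4
(N 1 6
(N 2 6
(N 3 6
(Y 7 6) (N 2 7
(Y 3 2) (N 4 5
B (N 1 2
(N 1 5
B (N 2 4
B (N 1 3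
(N 2 3
B (N 2 5
B (Y 2 1))) (L 2138705)))) (N 2 4
(N 1 5
B (N 1 3
(N 2 3
B (N 2 5
B (Y 2 1))) (D 1))) (L 8397009)))))) (N 2 7
(N 4 5
B (N 1 2
(N 1 5
B (N 2 4
B (N 1 3
(N 2 3
B (N 2 5
B (L 307841))) (L 2138705)))) (N 1 3
(N 1 5
B (N 2 4
(N 2 3
B (N 2 5
B (L 7176273))) (L 2138705))) (N 1 5
(N 2 3
(N 2 4
B (L 2138705)) (L 7079505)) (D 1))))) (Y 2 1))) (N 1 2
(N 1 3
(N 1 5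
(N 3 5
B (N 3 6
B (N 4 5
B (N 2 3
(N 2 4
B (N 2 5
B (N 2 6
B (L 930880)))) (N 2 4
(N 2 5
B (Y 5 4)) (L 308289)))))) (Y 1 0)) (L 7091729)) (L 7090385))) (N 1 2
(N 1 3
(N 1 5
(N 1 6
(N 2 3
B (N 2 5
B (N 2 6
B (N 2 4
(N 2 7
B (Y 2 0)) (L 537681))))) (N 3 6
(N 2 3
B (N 2 5
B (N 2 6
B (N 2 4
(N 2 7
B (Y 2 0)) (L 1060945))))) (L 1061393))) (L 7188497)) (L 7091729)) (L 7090385))) (D 0))) (N 0 4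
(N 0 5
(N 1 3
(N 1 4
(N 1 5
(N 1 6
B (N 1 2
(N 2 4
B (N 2 5
B (N 2 6
B (N 2 7
B (Y 2 0))))) (L 7079633))) (N 1 6
(N 4 5
B (N 2 5
(N 1 2
B (N 2 4
B (N 2 6
B (N 2 3
(N 2 7
B (Y 2 0)) (L 4727889))))) (N 3 5
(N 1 2
B (N 2 3
B (L 6391377))) (Y 5 4)))) (Y 1 0))) (N 1 6
(N 3 6
(N 2 6
(Y 7 6) (N 2 7
(N 1 5
B (N 1 2
(N 2 3
B (N 2 4
B (N 2 5
B (N 3 5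
B (L 144456))))) (D 1))) (Y 2 1))) (L 7091217)) (Y 1 0))) (N 1 2
(N 1 4
(N 1 5
(N 1 6
B (N 3 6
(N 2 4
B (N 2 5
B (N 2 6
B (N 2 3
(N 2 7
B (Y 2 0)) (L 1050193))))) (L 7341585))) (L 7177745)) (L 7091729)) (L 7079633))) (D 0)) (D 0))) (N 0 3
(N 0 4
(N 0 5
(N 1 2
(N 1 6
(N 2 6
(N 3 6
(Y 7 6) (N 2 7
(Y 3 2) (N 4 5
B (N 1 3
(N 1 4
B (N 1 5
B (N 2 4
(N 2 3
B (N 2 5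
B (L 6393937))) (L 6336593)))) (N 1 4
(N 1 5
B (N 2 3
(N 2 4
B (N 2 5
B (Y 2 1))) (L 4727441))) (L 7090705)))))) (N 2 7
(N 4 5
B (N 1 3
(N 1 4
B (N 1 5
B (N 2 4
(N 2 3
B (N 2 5
B (L 7176337))) (L 7090321)))) (N 2 3
(N 2 4
B (N 1 4
(N 1 5
B (N 2 5
B (L 7176337))) (L 7090321))) (L 7079569)))) (Y 2 1))) (N 1 3
(N 1 4
(N 1 5
(N 2 3
B (N 2 4
B (N 2 5
B (N 2 6
B (D 2))))) (Y 1 0)) (Y 1 0)) (Y 1 0))) (N 1 3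
(N 1 4
(N 1 5
(N 1 6
B (N 2 6
(N 2 3
B (N 2 4
B (N 2 5
B (D 2)))) (L 7340241))) (L 7176401)) (L 7090385)) (L 7079633))) (D 0)) (D 0)) (D 0)))))))) (Y 5 4)) (N 3 6
(Y 4 3) (N 3 5
(Y 6 5) (N 4 5
(Y 6 5) (N 2 6
(N 2 7
(Y 3 2) (N 0 7
(Y 2 0) (N 1 7
(Y 2 1) (N 2 4
(N 1 6
(N 2 5
(N 2 3
(N 0 2
(Y 7 2) (N 1 2
(Y 7 2) (N 1 3
(N 1 4
(N 1 5
(N 0 1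
(Y 2 1) (N 3 4
B (N 5 6
B (N 0 3
(N 0 4
B (Y 4 3)) (N 0 4
(N 0 5
B (D 0)) (D 0)))))) (N 0 5
(N 0 6
(Y 1 0) (N 0 1
(N 3 4
B (N 0 3
(N 0 4
B (Y 4 3)) (L 1094657))) (L 7176401))) (L 8487121))) (Y 4 3)) (N 0 3
(N 3 4
(N 5 6
(N 0 4
B (N 0 1
(N 0 5
B (N 0 6
B (D 0))) (L 6305489))) (Y 5 3)) (N 0 4
(N 1 5
(N 0 5
(N 0 6
B (Y 6 5)) (N 0 1
(N 0 6
(N 1 4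
B (N 5 6
B (L 1094664))) (L 1155585)) (L 6391505))) (L 406536)) (L 308233))) (L 8390353))))) (N 3 4
(N 5 6
(N 0 3
(N 0 1
(N 0 2
(N 0 4
B (N 0 5
B (N 0 6
B (L 1155585)))) (N 0 4
(N 0 5
B (N 0 6
B (N 1 3
(N 1 2
B (N 1 4
B (N 1 5
B (L 6370952)))) (L 4784785)))) (N 0 5
(N 0 6
B (L 6829697)) (L 6370945)))) (N 1 3
(N 0 2
(N 0 4
B (N 0 5
B (N 0 6
B (D 0)))) (N 0 4
(N 0 5
B (N 0 6
B (D 0))) (N 0 5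
(N 0 6
B (D 0)) (D 0)))) (N 0 2
(N 1 2
(N 0 4
B (N 0 5
B (L 6370833))) (L 8389329)) (L 8389329)))) (N 1 3
(N 1 2
(N 1 4
B (N 0 4
(N 0 1
B (N 0 2
B (L 8389841))) (L 4465737))) (N 0 1
(N 0 2
(N 1 4
B (N 0 4
(N 0 5
B (N 0 6
B (L 1152001))) (L 4465737))) (L 8389841)) (L 8389841))) (D 3))) (Y 5 3)) (N 0 3
(N 0 4
(N 1 3
(N 1 4
(N 1 5
(Y 2 1) (N 5 6
(N 1 2
B (N 0 1
(N 0 2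
B (N 0 5
B (L 6390409))) (N 0 2
(N 0 5
B (L 103505)) (L 2130641)))) (Y 5 4))) (L 308296)) (D 3)) (L 308289)) (D 3)))) (N 1 5
(Y 2 1) (N 0 5
(N 0 6
(Y 1 0) (N 5 6
(N 0 1
(N 0 2
(N 0 3
(N 0 4
(N 1 2
B (N 1 3
(N 1 4
B (L 6434952)) (L 4301960))) (N 1 4
(N 1 2
B (N 1 3
(N 2 3
B (Y 2 1)) (L 4301960))) (L 7184393))) (N 0 4
(N 1 3
(N 1 2
B (N 1 4
B (L 6434952))) (L 7177225)) (L 1094657))) (N 0 3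
(N 0 4
(N 1 2
(N 1 4
B (N 1 3
(N 2 3
B (L 4301896)) (L 406536))) (L 8421585)) (L 7184513)) (L 7177345))) (N 0 2
(N 0 3
(N 0 4
(N 1 2
(N 1 3
(N 1 4
B (L 7180305)) (L 7176721)) (L 8421585)) (L 7184401)) (L 7177233)) (L 8421585))) (D 5))) (D 5)))) (N 0 6
(Y 1 0) (N 5 6
(N 0 5
(N 1 5
(N 2 5
(Y 6 5) (N 0 4
(N 1 4
(N 0 3
(N 1 3
(N 0 1
B (N 0 2
(N 1 2
B (Y 1 0)) (L 9175249))) (Y 1 0)) (N 0 1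
(N 0 2
(N 1 2
B (N 1 3
B (Y 1 0))) (L 7177345)) (L 4989969))) (Y 1 0)) (N 0 1
(N 0 2
(N 0 3
(N 1 3
(N 1 2
B (N 1 4
(N 2 3
B (L 7176840)) (Y 1 0))) (L 4989961)) (L 1094657)) (L 7184513)) (L 7352337)))) (Y 1 0)) (N 0 3
(N 0 4
(N 1 5
(N 2 5
(Y 6 5) (L 4788297)) (L 856585)) (L 1155585)) (L 1152001))) (D 6)))) (N 2 3
(Y 4 3) (N 2 5
(N 5 6
(N 1 3
(N 1 4
(N 1 6
(N 1 5
(Y 2 1) (N 0 3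
(N 0 4
(N 0 5
(N 0 1
B (N 0 6
B (N 3 4
B (N 0 2
(N 1 2
B (L 6402696)) (L 7090817))))) (N 0 2
(N 1 2
(N 0 1
B (N 0 6
B (N 3 4
B (L 1155585)))) (L 2167433)) (L 2167433))) (Y 4 3)) (N 0 1
(N 0 4
(N 3 4
(N 0 5
B (N 0 2
(N 0 6
B (L 1152001)) (L 4785793))) (D 3)) (L 308289)) (L 4236369)))) (N 0 6
(Y 1 0) (N 0 2
(N 0 5
(Y 6 5) (N 0 3
(N 0 4
(N 1 2
(N 1 5
(Y 6 5) (L 856585)) (L 4788361)) (Y 4 3)) (L 1152001))) (L 2626185)))) (Y 4 3)) (N 0 3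
(N 0 4
(N 1 4
(N 3 4
(N 1 5
(N 1 6
(Y 2 1) (Y 6 5)) (N 0 1
(N 0 6
(Y 1 0) (N 1 2
(N 1 6
(N 0 2
B (N 0 5
B (L 2167433))) (Y 1 0)) (L 4785800))) (L 6325841))) (D 3)) (L 308296)) (L 4465737)) (D 3))) (L 1094720)) (L 406592))))))) (N 2 5
(Y 6 5) (N 2 3
(N 2 4
(N 3 4
(N 5 6
(N 1 5
(N 1 6
(N 1 7
(Y 2 1) (N 0 7
(Y 1 0) (N 2 7
(N 1 4
(N 1 2
B (N 1 3
B (N 0 1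
(N 0 2
B (N 0 3
B (L 296585))) (N 0 5
(N 0 2
B (N 0 3
B (L 296585))) (L 2167377))))) (N 1 2
(Y 4 2) (N 1 3
(Y 4 3) (N 0 1
(N 0 5
(N 0 6
(N 0 2
B (N 0 3
B (L 4465801))) (Y 6 5)) (L 2167377)) (D 1))))) (Y 2 1)))) (Y 6 5)) (N 0 5
(N 0 6
(N 0 7
(Y 1 0) (N 1 6
(N 1 7
(Y 2 1) (Y 1 0)) (L 856648))) (L 594505)) (D 5))) (Y 5 3)) (L 1155648)) (Y 4 3)) (L 1152064)))))))) (Y 6 3)) (Y 5 3)) (Y 4 3)) (N 0 7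
(Y 3 0) (N 1 7
(Y 3 1) (N 2 7
(Y 3 2) (N 4 7
(N 5 7
(N 6 7
(N 2 6
(N 3 6
(N 4 6
(N 5 6
(Y 7 6) (Y 5 4)) (N 4 5
(Y 6 5) (N 3 5
(N 3 4
(N 0 3
(Y 7 3) (N 1 3
(Y 7 3) (N 0 2
(N 1 2
(N 2 3
(Y 7 3) (N 0 1
(N 2 5
(N 2 4
(Y 3 2) (N 0 4
(N 1 4
(N 0 5
(N 0 6
B (N 1 5
B (N 1 6
B (Y 1 0)))) (N 1 5
(N 0 6
B (N 1 6
B (Y 6 5))) (L 8488465))) (L 8402568)) (L 8402561))) (N 0 5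
(N 0 6
(Y 2 0) (N 1 5
(N 1 6
(Y 2 1) (L 9176593)) (L 8488584))) (L 8488577))) (L 8390225))) (L 8390225)) (L 8390289)))) (N 2 4
(N 2 5
(Y 3 2) (N 1 5
(N 1 6
(Y 2 1) (N 0 6
(Y 1 0) (N 0 5
(N 0 4
(N 1 4
(N 0 3
(N 1 3
(N 0 1
B (N 0 2
(N 1 2
B (Y 1 0)) (L 6816913))) (Y 1 0)) (N 0 1
(N 0 2
(N 1 2
B (L 6816905)) (L 6816913)) (L 9176593))) (Y 1 0)) (N 0 1
(N 0 2
(N 0 3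
(N 1 3
(N 1 2
B (N 1 4
(N 2 3
B (L 6324873)) (D 4))) (L 6829065)) (L 9450497)) (L 7184513)) (L 7352337))) (L 4788297)))) (N 0 5
(N 0 6
(Y 1 0) (N 1 6
(N 0 1
(N 0 2
(N 0 3
(N 1 2
(N 1 3
B (N 1 4
(N 0 4
B (N 2 3
B (L 6394952))) (L 4797448))) (N 1 3
(N 1 4
(N 0 4
B (N 2 3
B (Y 2 1))) (L 6434952)) (L 8488584))) (N 0 4
(N 1 3
(N 2 3
(N 1 2
B (N 1 4
B (L 6434952))) (L 4789313)) (L 4789257)) (L 9450497))) (N 0 3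
(N 0 4
(N 1 2
(N 1 3
(N 1 4
B (N 2 3
B (L 6370376))) (L 6324881)) (L 6324873)) (L 7184513)) (L 6816913))) (N 0 2
(N 0 3
(N 0 4
(N 1 2
(N 1 3
(N 1 4
B (L 7180305)) (L 6324817)) (L 6324817)) (L 7184401)) (L 6816913)) (L 6816913))) (Y 1 0))) (L 4264521)))) (N 0 4
(N 1 4
(N 1 6
(N 1 5
(Y 2 1) (N 2 5
(N 1 2
(N 1 3
(N 0 2
(N 0 3
(N 0 1
B (N 0 5
B (N 0 6
B (N 2 3
B (N 5 6
B (L 9535505)))))) (Y 3 2)) (N 0 3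
(N 2 3
B (L 8394369)) (L 8394369))) (Y 3 2)) (N 0 1
(N 0 2
(N 0 3
(N 0 6
(Y 1 0) (N 0 5
(N 1 3
B (L 4789384)) (L 4788361))) (L 6296713)) (L 6296201)) (L 6324817))) (Y 2 1))) (N 0 6
(Y 1 0) (N 0 5
(N 1 5
(N 2 5
(Y 6 5) (N 0 2
(N 1 2
(N 2 3
(N 0 1
(N 0 3
B (N 1 3
B (L 7083017))) (N 0 3
(N 1 3
B (Y 1 0)) (L 9176593))) (L 4797504)) (L 7180424)) (L 7180417))) (Y 1 0)) (N 0 2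
(N 0 3
(N 1 2
(N 1 3
(N 2 5
(N 1 5
(Y 6 5) (N 0 1
(N 2 3
B (N 5 6
B (L 7438353))) (L 1150993))) (L 4788297)) (L 4789257)) (L 4788361)) (L 4789377)) (L 4789377))))) (D 4)) (D 4)))) (N 2 5
(Y 3 2) (N 0 5
(N 0 6
(Y 2 0) (N 1 5
(N 1 6
(Y 2 1) (N 2 4
(N 3 4
(N 5 6
(N 0 4
(N 1 4
(N 0 1
(N 0 2
B (N 0 3
B (L 8423041))) (N 0 2
(N 0 3
B (L 9176593)) (L 6816913))) (Y 1 0)) (N 0 1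
(N 0 2
(N 0 3
(N 1 4
(N 1 2
B (N 1 3
B (L 8423048))) (L 7352337)) (L 7185409)) (L 7184513)) (L 7352337))) (Y 5 4)) (Y 3 2)) (N 0 2
(N 0 4
(N 1 2
(N 1 4
(N 2 3
(N 3 4
(N 5 6
(N 0 1
B (N 0 3
B (L 9176593))) (Y 5 4)) (L 6435904)) (L 6435904)) (Y 1 0)) (L 7180424)) (L 7184449)) (L 7180417)))) (L 4264521))) (L 4264521)))))) (Y 3 2)) (N 0 6
(Y 2 0) (N 1 6
(Y 2 1) (N 0 1
(N 0 2
(N 1 2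
(N 3 6
(N 4 6
(N 5 6
(Y 7 6) (Y 5 4)) (L 4723273)) (L 6816329)) (L 9175177)) (L 9175177)) (L 9175121))))) (D 7)) (D 7)) (D 7))))))

/-- The diagonal pairs, which are never edges. -/
def diag : ℕ := 9241421688590303745

theorem diag_spec : ∀ u v, bt diag u v = true → u = v := by decide +kernel

theorem tree_ok : check tree 0 diag = true := by decide +kernel

theorem norm_good (F : SimpleGraph (Fin 8)) [DecidableRel F.Adj] (hF : Norm F) :
    ∃ n, Good F n :=
  check_sound F hF tree 0 diag (by simp [bt]) (fun u v h => by
    rw [diag_spec u v h]; exact F.irrefl) tree_ok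

theorem lower (V : Type) [Fintype V] (F : SimpleGraph V) (hV : Fintype.card V = 8)
    (hE : F.edgeSet.ncard < 15) : ¬ Arrows F (pathGraph 3) (cycleGraph 8) := by
  classical
  by_cases hlow : ∃ v, F.degree v ≤ 2
  · obtain ⟨v, hv⟩ := hlow
    exact low_degree hV F v hv
  push Not at hlow
  have hsum : ∑ v, F.degree v ≤ 28 := by
    rw [F.sum_degrees_eq_twice_card_edges]
    rw [← SimpleGraph.coe_edgeFinset, Set.ncard_coe_finset] at hE
    omega
  have : Nonempty (V ≃ Fin 8) := ⟨Fintype.equivFinOfCardEq hV⟩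
  let φ : (V ≃ Fin 8) → ℤ := fun e => ∑ u : Fin 8, ∑ v : Fin 8, (2 : ℤ) ^ u.val * 2 ^ v.val *
    (if F.Adj (e.symm u) (e.symm v) then 1 else 0)
  obtain ⟨e, he⟩ := Finite.exists_max φ
  let G : SimpleGraph (Fin 8) := F.comap e.symm
  have hG : ∀ u v, G.Adj u v ↔ F.Adj (e.symm u) (e.symm v) := fun u v => Iff.rfl
  have hdeg : ∀ u, ∑ w, (if G.Adj u w then 1 else 0) = F.degree (e.symm u) := by
    intro u
    rw [← F.card_neighborFinset_eq_degree, F.neighborFinset_eq_filter, Finset.card_filter,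
      ← Equiv.sum_comp e.symm]
    rfl
  have hnorm : Norm G := by
    constructor
    · intro v
      rw [hdeg]
      exact hlow _
    · simp only [hdeg]
      rw [Equiv.sum_comp e.symm (fun v => F.degree v)]
      exact hsum
    · intro i j hij
      have := swap_ineq (fun u : Fin 8 => (2 : ℤ) ^ u.val)
        (fun u v => if G.Adj u v then 1 else 0) (fun u v => by simp only [G.adj_comm])
        (fun u => by simp) i j hij.ne' (pow_lt_pow_right₀ (by norm_num) hij)
        (he (e.trans (Equiv.swap i j)))
      exact_mod_cast this
  obtain ⟨n, hn, hm⟩ := norm_good G hnorm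
  simp only [labOK, Bool.and_eq_true, Nat.ble_eq, List.all_eq_true, List.mem_range, any8_iff,
    beq_iff_eq] at hn
  apply tough hV F (fun v => lab n (e v)) (labZ n) hn.1
  · rw [labZ, sum8_eq, Finset.card_filter, ← Equiv.sum_comp e]
  · intro j hj
    obtain ⟨i, hi⟩ := hn.2 j hj
    exact ⟨e.symm i, by simpa using hi⟩
  · intro u v w h1 h2 h3 h4 h5 h6 h7
    apply e.injective
    exact hm (e u) (e v) (e w) (by simpa [hG] using h1) h2 h3 h4 (by simpa [hG] using h5) h6 h7

/-- The extremal graph on 15 edges. -/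
def ext : ℕ := 4115891919227210154

def extG : SimpleGraph (Fin 8) where
  Adj u v := bt ext u v = true
  symm := ⟨by decide +kernel⟩
  loopless := ⟨by decide +kernel⟩

instance : DecidableRel extG.Adj := fun u v => inferInstanceAs (Decidable (bt ext u v = true))

/-- Trees for the upper bound: `C` is a blue cycle, `M` asks whether an edge is red. -/
inductive U where
  | C (n : ℕ) : U
  | M (u v : Fin 8) (s t : U) : U

/-- Add all pairs which meet the edge `uv` in exactly one vertex. -/
def insAdj (E : ℕ) (u v : Fin 8) : ℕ :=
  ([0, 1, 2, 3, 4, 5, 6, 7] : List (Fin 8)).foldl (fun E w => if w = u ∨ w = v then E else ins (ins E u w) v w) E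

def vert (n : ℕ) (i : Fin 8) : Fin 8 := ⟨(n >>> (3 * i.val)) % 8, Nat.mod_lt _ (by norm_num)⟩

def checkU : U → ℕ → Bool
  | .C n, E => all8 (fun i => bt ext (vert n i) (vert n (i + 1)) &&
      bt E (vert n i) (vert n (i + 1))) &&
      all8 (fun i => all8 (fun j => decide (i = j) || !decide (vert n i = vert n j)))
  | .M u v s t, E => checkU s (insAdj E u v) && checkU t (ins E u v)

theorem bt_insAdj (E : ℕ) (u v a b : Fin 8) (h : bt (insAdj E u v) a b = true) :
    bt E a b = true ∨ ∃ w, w ≠ u ∧ w ≠ v ∧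
      ((a = u ∧ b = w) ∨ (a = w ∧ b = u) ∨ (a = v ∧ b = w) ∨ (a = w ∧ b = v)) := by
  unfold insAdj at h
  generalize ([0, 1, 2, 3, 4, 5, 6, 7] : List (Fin 8)) = l at h
  induction l generalizing E with
  | nil => exact Or.inl h
  | cons w l ih =>
    rw [List.foldl_cons] at h
    rcases ih _ h with h' | h'
    · by_cases hw : w = u ∨ w = v
      · rw [if_pos hw] at h'; exact Or.inl h'
      · rw [if_neg hw, bt_ins, bt_ins] at h'
        push Not at hw
        rcases h' with (h' | h') | h'
        · exact Or.inl h'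
        · exact Or.inr ⟨w, hw.1, hw.2, by tauto⟩
        · exact Or.inr ⟨w, hw.1, hw.2, by tauto⟩
    · exact Or.inr h'

theorem checkU_sound (R : SimpleGraph (Fin 8))
    (hR : ∀ a b c, R.Adj a b → R.Adj a c → b = c) (t : U) :
    ∀ E, (∀ u v, bt E u v = true → ¬ R.Adj u v) → checkU t E = true →
      Contains (extG \ R) (cycleGraph 8) := by
  induction t with
  | C n =>
    intro E hE hc
    simp only [checkU, Bool.and_eq_true, all8_iff] at hc
    have hstep : ∀ i : Fin 8, (extG \ R).Adj (vert n i) (vert n (i + 1)) := by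
      intro i
      rw [SimpleGraph.sdiff_adj]
      exact ⟨(hc.1 i).1, hE _ _ (hc.1 i).2⟩
    refine ⟨⟨vert n, ?_⟩, ?_⟩
    · intro a b hab
      rw [cycleGraph_adj] at hab
      rcases hab with h | h
      · have : a = b + 1 := by rw [← h]; abel
        rw [this]; exact (hstep b).symm
      · have : b = a + 1 := by rw [← h]; abel
        rw [this]; exact hstep a
    · intro i j hij
      have := hc.2 i j
      by_contra hne
      have hij' : vert n i = vert n j := hij
      simp [hne, hij'] at this
  | M u v s t ihs iht =>
    intro E hE hc
    simp only [checkU, Bool.and_eq_true] at hc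
    by_cases h : R.Adj u v
    · apply ihs _ _ hc.1
      intro a b hab hadj
      rcases bt_insAdj _ _ _ _ _ hab with h' | ⟨w, hu, hv, h'⟩
      · exact hE a b h' hadj
      · rcases h' with ⟨rfl, rfl⟩ | ⟨rfl, rfl⟩ | ⟨rfl, rfl⟩ | ⟨rfl, rfl⟩
        · exact hv (hR _ _ _ hadj h)
        · exact hv (hR _ _ _ hadj.symm h)
        · exact hu (hR _ _ _ hadj h.symm)
        · exact hu (hR _ _ _ hadj.symm h.symm)
    · apply iht _ _ hc.2
      intro a b hab
      rcases (bt_ins _ _ _ _ _).1 hab with h' | ⟨rfl, rfl⟩ | ⟨rfl, rfl⟩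
      · exact hE a b h'
      · exact h
      · exact fun h' => h h'.symm

open U in
def utree : U :=
(M 0 1 (M 2 6 (M 5 7 (C 15526056)
(C 16075864))
(M 2 4 (C 15903832)
(M 4 5 (C 12463192)
(M 5 7 (C 15903832)
(C 16133208)))))
(M 1 3 (M 2 6 (M 5 7 (C 11171720)
(C 8300936))
(M 2 4 (C 8279432)
(M 4 5 (C 11171720)
(M 5 7 (C 8279432)
(C 8308104)))))
(M 3 6 (M 4 7 (C 8308104)
(M 2 5 (C 8308104)
(M 0 5 (C 8279432)
(C 11226824))))
(M 2 6 (M 5 7 (C 11171720)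
(M 0 7 (C 11171720)
(C 16075976)))
(M 2 4 (M 0 7 (C 11226824)
(C 15903944))
(M 4 5 (C 12463304)
(M 5 7 (C 15903944)
(M 0 7 (C 12463304)
(C 16133320)))))))))

theorem utree_ok : checkU utree 0 = true := by decide +kernel

theorem path_of_not_matching (R : SimpleGraph (Fin 8)) (a b c : Fin 8) (h1 : R.Adj a b)
    (h2 : R.Adj a c) (hne : b ≠ c) : Contains R (pathGraph 3) := by
  refine ⟨⟨![b, a, c], ?_⟩, ?_⟩
  · intro i j hij
    rw [pathGraph_adj] at hij
    fin_cases i <;> fin_cases j <;> simp_all [R.adj_comm]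
  · have hab := h1.ne
    have hac := h2.ne
    intro i j hij
    change ![b, a, c] i = ![b, a, c] j at hij
    fin_cases i <;> fin_cases j <;> simp_all

theorem upper : ∃ F : SimpleGraph (Fin 8), F.edgeSet.ncard = 15 ∧
    Arrows F (pathGraph 3) (cycleGraph 8) := by
  refine ⟨extG, ?_, ?_⟩
  · rw [← SimpleGraph.coe_edgeFinset, Set.ncard_coe_finset]
    have h := extG.sum_degrees_eq_twice_card_edges
    have h2 : ∑ v, extG.degree v = 30 := by decide +kernel
    omega
  · intro R _
    by_cases hR : ∀ a b c, R.Adj a b → R.Adj a c → b = c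
    · exact Or.inr (checkU_sound R hR utree 0 (by simp [bt]) utree_ok)
    · push Not at hR
      obtain ⟨a, b, c, h1, h2, h3⟩ := hR
      exact Or.inl (path_of_not_matching R a b c h1 h2 h3)

end RStar

theorem stmt_8 :
    (∃ F : SimpleGraph (Fin 8), F.edgeSet.ncard = 15 ∧
      Arrows F (pathGraph 3) (cycleGraph 8)) ∧
    (∀ (V : Type) [Fintype V] (F : SimpleGraph V), Fintype.card V = 8 →
      F.edgeSet.ncard < 15 → ¬ Arrows F (pathGraph 3) (cycleGraph 8)) :=  by
  exact ⟨RStar.upper, fun V _ F hV hE => RStar.lower V F hV hE⟩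
end
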